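/- arXiv:2406.07326 — 2 statements merged into one kernel-verified Lean document; each statement's English description precedes it below -/
import Mathlib

section
/- Let q be a prime power, F a finite field with q^2 elements, 1 < d ≤ q, and G ∈ F[x_0,...,x_4] a nonzero homogeneous polynomial of degree d such that no plane of ℙ^4(F) is contained in V(G)(F). If there exist a plane Π_0 of ℙ^4(F) and d pairwise distinct generators of V_3 all contained in Π_0 ∩ V(G)(F), then |V(G)(F) ∩ V_3| ≤ dq^5 − q^4 + dq^3 + dq^2 + 1 < d(q^5 + q^2) + q^3 + 1. -/
open MvPolynomial

noncomputable section

/-- The projective space ℙ⁴(F): 1-dimensional F-linear subspaces of F⁵. -/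
abbrev P4 (F : Type) [Field F] := Projectivization F (Fin 5 → F)

/-- The non-degenerate Hermitian threefold
    V₃ = {[x] ∈ ℙ⁴(F) : x₀^{q+1} + ⋯ + x₄^{q+1} = 0}. -/
def hermV3 (q : ℕ) (F : Type) [Field F] : Set (P4 F) :=
  {x | ∑ i, x.rep i ^ (q + 1) = 0}

/-- V(G)(F) = {[x] ∈ ℙ⁴(F) : G(x) = 0}, for G homogeneous this is well defined. -/
def VG {F : Type} [Field F] (G : MvPolynomial (Fin 5) F) : Set (P4 F) :=
  {x | eval x.rep G = 0}

/-- The set of points of ℙ⁴(F) contained in an F-linear subspace of F⁵ of dimension k. -/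
def IsLinSub (F : Type) [Field F] (k : ℕ) (S : Set (P4 F)) : Prop :=
  ∃ W : Submodule F (Fin 5 → F), Module.finrank F W = k ∧
    S = {x : P4 F | x.submodule ≤ W}

/-- A line of ℙ⁴(F). -/
def IsLine (F : Type) [Field F] (S : Set (P4 F)) : Prop := IsLinSub F 2 S

/-- A plane of ℙ⁴(F). -/
def IsPlane (F : Type) [Field F] (S : Set (P4 F)) : Prop := IsLinSub F 3 S

/-- A hyperplane of ℙ⁴(F). -/
def IsHyperplane (F : Type) [Field F] (S : Set (P4 F)) : Prop := IsLinSub F 4 S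

/-- The tangent hyperplane T_P(V₃) = {[x] : a₀^q x₀ + ⋯ + a₄^q x₄ = 0} where P = [a]. -/
def tangentHyp (q : ℕ) {F : Type} [Field F] (P : P4 F) : Set (P4 F) :=
  {x | ∑ i, P.rep i ^ q * x.rep i = 0}

/-- A subset of ℙ⁴(F) is a tangent hyperplane to V₃ if it equals T_P(V₃) for some P ∈ V₃. -/
def IsTangentHyp (q : ℕ) {F : Type} [Field F] (S : Set (P4 F)) : Prop :=
  ∃ P ∈ hermV3 q F, S = tangentHyp q P

section Restriction

variable {ι F : Type} [Field F]

/-- The univariate polynomial `t ↦ G (u + t v)`. -/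
def lineRestr (G : MvPolynomial ι F) (u v : ι → F) : Polynomial F :=
  aeval (fun i => Polynomial.C (u i) + Polynomial.C (v i) * Polynomial.X) G

theorem eval_lineRestr (G : MvPolynomial ι F) (u v : ι → F) (t : F) :
    (lineRestr G u v).eval t = eval (u + t • v) G := by
  have h : ((Polynomial.aeval t).comp
      (aeval (fun i => Polynomial.C (u i) + Polynomial.C (v i) * Polynomial.X))) =
      (aeval (u + t • v) : MvPolynomial ι F →ₐ[F] F) := by
    ext i
    simp only [AlgHom.coe_comp, Function.comp_apply, aeval_X, map_add, map_mul,
      Polynomial.aeval_X, Polynomial.aeval_C, Pi.add_apply, Pi.smul_apply, smul_eq_mul,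
      Algebra.algebraMap_self, RingHom.id_apply]
    ring
  have h' := DFunLike.congr_fun h G
  simpa [lineRestr, Polynomial.aeval_def, Polynomial.eval₂_eq_eval_map, aeval_eq_eval] using h'

theorem natDegree_lineRestr_le {G : MvPolynomial ι F} {d : ℕ} (hG : G.totalDegree ≤ d)
    (u v : ι → F) : (lineRestr G u v).natDegree ≤ d := by
  have := aeval_natDegree_le (n := 1) G hG
    (fun i => Polynomial.C (u i) + Polynomial.C (v i) * Polynomial.X) (fun i => by
      rw [add_comm]; exact Polynomial.natDegree_linear_le)
  simpa [lineRestr] using this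

theorem lineRestr_comp (G : MvPolynomial ι F) (u v : ι → F) (t : F) :
    (lineRestr G u v).comp (Polynomial.X + Polynomial.C t) = lineRestr G (u + t • v) v := by
  have h : ((Polynomial.aeval (Polynomial.X + Polynomial.C t)).comp
      (aeval (fun i => Polynomial.C (u i) + Polynomial.C (v i) * Polynomial.X))) =
      (aeval (fun i => Polynomial.C ((u + t • v) i) + Polynomial.C (v i) * Polynomial.X) :
        MvPolynomial ι F →ₐ[F] Polynomial F) := by
    ext1 i
    simp only [AlgHom.coe_comp, Function.comp_apply, aeval_X, map_add, map_mul,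
      Polynomial.aeval_X, Polynomial.aeval_C, Pi.add_apply, Pi.smul_apply, smul_eq_mul,
      Polynomial.algebraMap_eq]
    ring
  exact DFunLike.congr_fun h G

theorem polynomial_eq_zero_of_forall_eval [Fintype F] {p : Polynomial F}
    (hp : p.natDegree < Fintype.card F) (h : ∀ t, p.eval t = 0) : p = 0 :=
  Polynomial.eq_zero_of_natDegree_lt_card_of_eval_eq_zero' p Finset.univ (fun t _ => h t)
    (by simpa using hp)

/-- The bivariate polynomial `G (Q + s (A + y B))`, in the variable `s` over `F[y]`. -/
def pencilRestr (G : MvPolynomial ι F) (Q B A : ι → F) : Polynomial (Polynomial F) :=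
  aeval (fun i => Polynomial.C (Polynomial.C (Q i)) +
    Polynomial.C (Polynomial.C (A i) + Polynomial.C (B i) * Polynomial.X) * Polynomial.X) G

theorem map_pencilRestr (G : MvPolynomial ι F) (Q B A : ι → F) (y : F) :
    (pencilRestr G Q B A).map (Polynomial.evalRingHom y) = lineRestr G Q (A + y • B) := by
  have h : ((Polynomial.mapAlgHom (Polynomial.aeval y : Polynomial F →ₐ[F] F)).comp
      (aeval (fun i => Polynomial.C (Polynomial.C (Q i)) +
    Polynomial.C (Polynomial.C (A i) + Polynomial.C (B i) * Polynomial.X) * Polynomial.X))) =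
      (aeval (fun i => Polynomial.C (Q i) + Polynomial.C ((A + y • B) i) * Polynomial.X) :
        MvPolynomial ι F →ₐ[F] Polynomial F) := by
    ext1 i
    simp only [AlgHom.coe_comp, Function.comp_apply, aeval_X, Polynomial.coe_mapAlgHom,
      Polynomial.map_add, Polynomial.map_mul, Polynomial.map_C, Polynomial.map_X,
      RingHom.coe_coe, map_add, map_mul, Polynomial.aeval_X, Polynomial.aeval_C,
      Pi.add_apply, Pi.smul_apply, smul_eq_mul, Algebra.algebraMap_self, RingHom.id_apply]
    ring
  exact DFunLike.congr_fun h G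

theorem diagonal_coeff_mul {Ψ : Polynomial (Polynomial F)} {p : Polynomial F}
    (h : ∀ j, (Ψ.coeff j).natDegree ≤ j ∧ (Ψ.coeff j).coeff j = p.coeff j) (a b c : F) (j : ℕ) :
    ((Ψ * (Polynomial.C (Polynomial.C a) + Polynomial.C (Polynomial.C b + Polynomial.C c *
      Polynomial.X) * Polynomial.X)).coeff j).natDegree ≤ j ∧
    ((Ψ * (Polynomial.C (Polynomial.C a) + Polynomial.C (Polynomial.C b + Polynomial.C c *
      Polynomial.X) * Polynomial.X)).coeff j).coeff j =
      (p * (Polynomial.C a + Polynomial.C c * Polynomial.X)).coeff j := by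
  have hlin : (Polynomial.C b + Polynomial.C c * Polynomial.X).natDegree ≤ 1 := by
    rw [add_comm]
    exact Polynomial.natDegree_linear_le
  rcases j with _ | j
  · obtain ⟨h1, h2⟩ := h 0
    rw [mul_add, Polynomial.coeff_add, Polynomial.coeff_mul_C, ← mul_assoc,
      Polynomial.coeff_mul_X_zero, add_zero, Polynomial.coeff_mul_C, h2, mul_add,
      Polynomial.coeff_add, Polynomial.coeff_mul_C, ← mul_assoc, Polynomial.coeff_mul_X_zero,
      add_zero]
    exact ⟨(Polynomial.natDegree_mul_C_le _ _).trans h1, rfl⟩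
  · obtain ⟨h1, h2⟩ := h j
    obtain ⟨h3, h4⟩ := h (j + 1)
    rw [mul_add, Polynomial.coeff_add, Polynomial.coeff_mul_C, ← mul_assoc,
      Polynomial.coeff_mul_X, Polynomial.coeff_mul_C, Polynomial.coeff_add, Polynomial.coeff_mul_C,
      h4, mul_add p, Polynomial.coeff_add, Polynomial.coeff_mul_C, ← mul_assoc,
      Polynomial.coeff_mul_X, Polynomial.coeff_mul_C, mul_add (Ψ.coeff j), Polynomial.coeff_add,
      Polynomial.coeff_mul_C, ← mul_assoc, Polynomial.coeff_mul_X, Polynomial.coeff_mul_C, h2,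
      Polynomial.coeff_eq_zero_of_natDegree_lt (Nat.lt_succ_of_le h1), zero_mul, zero_add]
    refine ⟨(Polynomial.natDegree_add_le _ _).trans (max_le ?_ ?_), rfl⟩
    · exact (Polynomial.natDegree_mul_C_le _ _).trans h3
    · rw [mul_assoc, ← mul_add]
      exact Polynomial.natDegree_mul_le.trans (Nat.add_le_add h1 hlin)

theorem coeff_pencilRestr (G : MvPolynomial ι F) (Q B A : ι → F) (j : ℕ) :
    ((pencilRestr G Q B A).coeff j).natDegree ≤ j ∧
      ((pencilRestr G Q B A).coeff j).coeff j = (lineRestr G Q B).coeff j := by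
  induction G using MvPolynomial.induction_on generalizing j with
  | C a =>
    have h1 : pencilRestr (C a) Q B A = Polynomial.C (Polynomial.C a) := algHom_C _ _
    have h2 : lineRestr (C a) Q B = Polynomial.C a := algHom_C _ _
    rw [h1, h2]
    rcases j with _ | j <;> simp [Polynomial.coeff_C]
  | add p r hp hr =>
    rw [pencilRestr, lineRestr, map_add, map_add, Polynomial.coeff_add, Polynomial.coeff_add,
      Polynomial.coeff_add]
    exact ⟨(Polynomial.natDegree_add_le _ _).trans (max_le (hp j).1 (hr j).1),
      congrArg₂ _ (hp j).2 (hr j).2⟩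
  | mul_X p i hp =>
    rw [pencilRestr, lineRestr, map_mul, map_mul, aeval_X, aeval_X]
    exact diagonal_coeff_mul hp _ _ _ j

/-- If `G` vanishes on `k` concurrent lines of a plane, its restriction to any other line of that
plane through the common point has a zero of order at least `k` there. -/
theorem coeff_lineRestr_eq_zero [Fintype F] {G : MvPolynomial ι F}
    (hG : G.totalDegree < Fintype.card F) {Q B A : ι → F} {Y : Finset F}
    (hY : ∀ y ∈ Y, ∀ s : F, eval (Q + s • (A + y • B)) G = 0) {j : ℕ} (hj : j < Y.card) :
    (lineRestr G Q B).coeff j = 0 := by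
  rw [← (coeff_pencilRestr G Q B A j).2]
  have : (pencilRestr G Q B A).coeff j = 0 := by
    refine Polynomial.eq_zero_of_natDegree_lt_card_of_eval_eq_zero' _ Y (fun y hy => ?_)
      ((coeff_pencilRestr G Q B A j).1.trans_lt hj)
    have h0 : lineRestr G Q (A + y • B) = 0 :=
      polynomial_eq_zero_of_forall_eval ((natDegree_lineRestr_le le_rfl _ _).trans_lt hG)
        (fun s => by rw [eval_lineRestr, hY y hy])
    have := congrArg (fun p => Polynomial.coeff p j) (map_pencilRestr G Q B A y)
    simpa [h0] using this
  rw [this, Polynomial.coeff_zero]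

theorem eval_smul_of_isHomogeneous {G : MvPolynomial ι F} {d : ℕ} (hG : G.IsHomogeneous d)
    (c : F) (v : ι → F) : eval (c • v) G = c ^ d * eval v G := by
  rw [eval_eq, eval_eq, Finset.mul_sum]
  refine Finset.sum_congr rfl fun m hm => ?_
  have hd : ∑ i ∈ m.support, m i = d := by
    have := hG (mem_support_iff.1 hm)
    rwa [Pi.one_def, ← Finsupp.degree_eq_weight_one, Finsupp.degree_apply] at this
  simp only [Pi.smul_apply, smul_eq_mul, mul_pow, Finset.prod_mul_distrib,
    Finset.prod_pow_eq_pow_sum, hd]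
  ring

theorem reflect_lineRestr [Fintype F] {G : MvPolynomial ι F} {d : ℕ} (hG : G.IsHomogeneous d)
    (hd : d + 1 < Fintype.card F) (u v : ι → F) :
    (lineRestr G u v).reflect d = lineRestr G v u := by
  classical
  have htd := hG.totalDegree_le
  refine Polynomial.eq_of_natDegree_lt_card_of_eval_eq' _ _ (Finset.univ.erase 0)
    (fun t ht => ?_) ?_
  · have ht0 : t ≠ 0 := (Finset.mem_erase.1 ht).1
    have := invertibleOfNonzero (inv_ne_zero ht0)
    have h := Polynomial.eval₂_reflect_mul_pow (RingHom.id F) t⁻¹ d (lineRestr G u v)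
      (natDegree_lineRestr_le htd _ _)
    simp only [invOf_eq_inv, inv_inv] at h
    change ((lineRestr G u v).reflect d).eval t * _ = (lineRestr G u v).eval t⁻¹ at h
    rw [eval_lineRestr] at h ⊢
    have hv : v + t • u = t • (u + t⁻¹ • v) := by
      rw [smul_add, smul_smul, mul_inv_cancel₀ ht0, one_smul, add_comm]
    rw [hv, eval_smul_of_isHomogeneous hG, ← h, mul_comm, mul_assoc, ← mul_pow,
      inv_mul_cancel₀ ht0, one_pow, mul_one]
  · rw [Finset.card_erase_of_mem (Finset.mem_univ _), Finset.card_univ]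
    have h1 := natDegree_lineRestr_le htd v u
    have h2 : ((lineRestr G u v).reflect d).natDegree ≤ d := by
      rw [Polynomial.natDegree_le_iff_coeff_eq_zero]
      intro n hn
      rw [Polynomial.coeff_reflect, Polynomial.revAt_eq_self_of_lt hn]
      exact Polynomial.coeff_eq_zero_of_natDegree_lt
        ((natDegree_lineRestr_le htd u v).trans_lt hn)
    omega

theorem coeff_lineRestr [Fintype F] {G : MvPolynomial ι F} {d : ℕ} (hG : G.IsHomogeneous d)
    (hd : d + 1 < Fintype.card F) (u v : ι → F) {j : ℕ} (hj : j ≤ d) :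
    (lineRestr G u v).coeff (d - j) = (lineRestr G v u).coeff j := by
  rw [← reflect_lineRestr hG hd, Polynomial.coeff_reflect, Polynomial.revAt_le (Nat.sub_le _ _),
    Nat.sub_sub_self hj]

theorem coeff_lineRestr_top [Fintype F] {G : MvPolynomial ι F} {d : ℕ} (hG : G.IsHomogeneous d)
    (hd : d + 1 < Fintype.card F) (u v : ι → F) :
    (lineRestr G u v).coeff d = eval v G := by
  have h := coeff_lineRestr hG hd u v (Nat.zero_le d)
  rw [Nat.sub_zero] at h
  rw [h, Polynomial.coeff_zero_eq_eval_zero, eval_lineRestr, zero_smul, add_zero]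

/-- If the homogeneous form `G` vanishes on `k` lines through `B` in the plane of `v, B, A`, other
than the line of `v, B` on which it does not vanish, it has at most `d - k` zeros on the latter
besides `B`. -/
theorem card_zeros_add_card_le [Fintype F] [DecidableEq F] {G : MvPolynomial ι F} {d : ℕ}
    (hG : G.IsHomogeneous d) (hd : d + 1 < Fintype.card F) {v B A : ι → F} {Y : Finset F}
    (hY : ∀ y ∈ Y, ∀ s : F, eval (B + s • (A + y • v)) G = 0)
    (hne : ∃ t : F, eval (v + t • B) G ≠ 0) :
    (Finset.univ.filter fun t : F => eval (v + t • B) G = 0).card + Y.card ≤ d := by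
  have htd := hG.totalDegree_le
  have hp : lineRestr G v B ≠ 0 := by
    obtain ⟨t, ht⟩ := hne
    intro h
    apply ht
    rw [← eval_lineRestr, h, Polynomial.eval_zero]
  have hdeg : (lineRestr G v B).natDegree + Y.card ≤ d := by
    by_contra! hlt
    have hle := natDegree_lineRestr_le htd v B
    have := coeff_lineRestr hG hd v B (j := d - (lineRestr G v B).natDegree) (Nat.sub_le _ _)
    rw [Nat.sub_sub_self hle, coeff_lineRestr_eq_zero (by omega) hY (by omega)] at this
    exact hp (Polynomial.leadingCoeff_eq_zero.1 this)
  refine le_trans (Nat.add_le_add_right ?_ _) hdeg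
  refine le_trans (Finset.card_le_card (t := (lineRestr G v B).roots.toFinset) fun t ht => ?_)
    ((Multiset.toFinset_card_le _).trans (Polynomial.card_roots' _))
  rw [Multiset.mem_toFinset, Polynomial.mem_roots hp, Polynomial.IsRoot, eval_lineRestr]
  exact (Finset.mem_filter.1 ht).2

theorem sum_le_of_le_order [Fintype F] [DecidableEq F] {G : MvPolynomial ι F} {d : ℕ}
    (hG : G.totalDegree ≤ d) {v B : ι → F} (hne : lineRestr G v B ≠ 0) (κ : F → ℕ)
    (hκ : ∀ t j, j < κ t → (lineRestr G (v + t • B) B).coeff j = 0) :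
    ∑ t, κ t ≤ d := by
  have key : ∀ t, κ t ≤ (lineRestr G v B).roots.count t := fun t => by
    rw [Polynomial.count_roots, Polynomial.rootMultiplicity_eq_rootMultiplicity, lineRestr_comp]
    have hne' : lineRestr G (v + t • B) B ≠ 0 := by
      rw [← lineRestr_comp]
      intro h
      rw [← Polynomial.taylor_apply] at h
      exact hne (Polynomial.taylor_injective t (by rw [h, map_zero]))
    rw [Polynomial.le_rootMultiplicity_iff hne', Polynomial.C_0, sub_zero,
      Polynomial.X_pow_dvd_iff]
    exact fun j hj => hκ t j hj
  calc ∑ t, κ t ≤ ∑ t, (lineRestr G v B).roots.count t := Finset.sum_le_sum fun t _ => key t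
    _ = Multiset.card (lineRestr G v B).roots :=
      Multiset.sum_count_eq_card fun _ _ => Finset.mem_univ _
    _ ≤ d := (Polynomial.card_roots' _).trans (natDegree_lineRestr_le hG _ _)

end Restriction

section AffineCurve

variable {F : Type} [Field F] [Fintype F]

/-- A plane curve of degree `d ≤ q` whose equation involves `y ^ d` meets the affine curve
`x ^ (q + 1) = e (y ^ q + y)` in at most `d (q + 1)` points. -/
theorem card_le_of_mem_curve {q d : ℕ} (hq : 1 < q) (hdq : d ≤ q) {f : MvPolynomial (Fin 2) F}
    (hf : f.totalDegree ≤ d) (hc : coeff (Finsupp.single 1 d) f ≠ 0) (e : F)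
    (T : Finset (Fin 2 → F))
    (hT : ∀ p ∈ T, eval p f = 0 ∧ p 0 ^ (q + 1) = e * (p 1 ^ q + p 1)) :
    T.card ≤ d * (q + 1) := by
  classical
  set mono : ℕ → ℕ → T → F := fun i j p => p.1 0 ^ i * p.1 1 ^ j with hmono
  set D : Submodule F (T → F) :=
    Submodule.span F (Set.range fun ij : Fin d × Fin (q + 1) => mono ij.2 ij.1) with hD
  have hsupp : ∀ m ∈ f.support, m ≠ Finsupp.single 1 d →
      q * m 0 + (q + 1) * m 1 < (q + 1) * d := by
    intro m hm hne
    have hle : m 0 + m 1 ≤ d := by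
      have := (le_totalDegree hm).trans hf
      rwa [Finsupp.sum_fintype _ _ (fun _ => rfl), Fin.sum_univ_two] at this
    rcases Nat.eq_zero_or_pos (m 0) with h0 | h0
    · have h1 : m 1 ≠ d := by
        intro h1
        apply hne
        ext k
        fin_cases k <;> simp [h0, h1]
      have : m 1 < d := by omega
      rw [h0]
      nlinarith
    · nlinarith
  have hstep : ∀ i j, d ≤ j →
      (∀ i' j', q * i' + (q + 1) * j' < q * i + (q + 1) * j → mono i' j' ∈ D) →
      mono i j ∈ D := by
    intro i j hj ih
    have hsum : coeff (Finsupp.single 1 d) f • mono i j =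
        -∑ m ∈ f.support.erase (Finsupp.single 1 d),
          coeff m f • mono (i + m 0) (j - d + m 1) := by
      funext p
      have h0 := (hT p.1 p.2).1
      rw [eval_eq', ← Finset.add_sum_erase _ _ (mem_support_iff.2 hc)] at h0
      simp only [Fin.prod_univ_two] at h0
      have h1 := congrArg (fun z => p.1 0 ^ i * p.1 1 ^ (j - d) * z) h0
      simp only [mul_add, Finset.mul_sum, mul_zero] at h1
      simp only [hmono, Pi.smul_apply, Pi.neg_apply, Finset.sum_apply, smul_eq_mul]
      rw [← Nat.sub_add_cancel hj, pow_add, eq_neg_iff_add_eq_zero, ← h1]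
      congr 1
      · simp
        ring
      · refine Finset.sum_congr rfl fun m _ => ?_
        rw [Nat.add_sub_cancel]
        ring
    rw [← D.smul_mem_iff hc, hsum]
    refine D.neg_mem (D.sum_mem fun m hm => D.smul_mem _ (ih _ _ ?_))
    have := hsupp m (Finset.mem_of_mem_erase hm) (Finset.ne_of_mem_erase hm)
    obtain ⟨k, rfl⟩ := Nat.exists_eq_add_of_le hj
    rw [Nat.add_sub_cancel_left]
    nlinarith
  have hall : ∀ n i j, q * i + (q + 1) * j = n → mono i j ∈ D := by
    intro n
    induction n using Nat.strong_induction_on with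
    | _ n ih =>
      intro i j hn
      have ih' : ∀ i' j', q * i' + (q + 1) * j' < q * i + (q + 1) * j → mono i' j' ∈ D :=
        fun i' j' h => ih _ (hn ▸ h) i' j' rfl
      rcases le_or_gt d j with hj | hj
      · exact hstep i j hj ih'
      rcases le_or_gt (q + 1) i with hi | hi
      · obtain ⟨i, rfl⟩ := Nat.exists_eq_add_of_le hi
        have : mono (q + 1 + i) j = e • (mono i (j + q) + mono i (j + 1)) := by
          funext p
          simp only [hmono, Pi.smul_apply, Pi.add_apply, smul_eq_mul, pow_add _ (q + 1) i,
            (hT p.1 p.2).2]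
          ring
        rw [this]
        refine D.smul_mem _ (D.add_mem (hstep _ _ (by omega) fun i' j' h => ih' _ _ ?_)
          (ih' _ _ ?_))
        · nlinarith
        · nlinarith
      · exact Submodule.subset_span ⟨(⟨j, hj⟩, ⟨i, hi⟩), rfl⟩
  have htop : D = ⊤ := by
    rw [eq_top_iff]
    intro g _
    obtain ⟨r, -, hr⟩ : (fun p => if h : p ∈ T then g ⟨p, h⟩ else 0) ∈
        (restrictDegree (Fin 2) F (Fintype.card F - 1)).map (evalₗ F (Fin 2)) := by
      rw [map_restrict_dom_evalₗ]
      trivial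
    have hg : g = ∑ m ∈ r.support, coeff m r • mono (m 0) (m 1) := by
      funext p
      have := congrFun hr p.1
      rw [dif_pos p.2, evalₗ_apply, eval_eq'] at this
      rw [← this]
      simp [hmono, Fin.prod_univ_two]
    rw [hg]
    exact D.sum_mem fun m _ => D.smul_mem _ (hall _ _ _ rfl)
  have hcard := finrank_range_le_card (R := F) fun ij : Fin d × Fin (q + 1) => mono ij.2 ij.1
  rw [Set.finrank, ← hD, htop, finrank_top, Module.finrank_fintype_fun_eq_card] at hcard
  simpa using hcard

end AffineCurve

section HermitianForm

/-- `F` is a field with `q ^ 2` elements on which `x ↦ x ^ q` is additive. -/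
structure IsHermitianField (q : ℕ) (F : Type) [Field F] [Fintype F] : Prop where
  one_lt : 1 < q
  card_eq : Fintype.card F = q ^ 2
  add_pow : ∀ x y : F, (x + y) ^ q = x ^ q + y ^ q

theorem isHermitianField_of_isPrimePow {q : ℕ} (hq : IsPrimePow q) {F : Type} [Field F] [Fintype F]
    (hF : Fintype.card F = q ^ 2) : IsHermitianField q F where
  one_lt := hq.one_lt
  card_eq := hF
  add_pow := by
    obtain ⟨p, k, hp, hk, rfl⟩ := hq
    have hp' : p.Prime := hp.nat_prime
    obtain ⟨p', hchar⟩ := CharP.exists F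
    obtain ⟨n, hp'', hn⟩ := FiniteField.card F p'
    have : p = p' := by
      have h1 : p ∣ p' ^ (n : ℕ) := by
        rw [← hn, hF, ← pow_mul]
        exact dvd_pow_self _ (by omega)
      exact (Nat.prime_dvd_prime_iff_eq hp' hp'').1 (hp'.dvd_of_dvd_pow h1)
    subst this
    have := Fact.mk hp'
    exact fun x y => add_pow_char_pow x y p k

variable {q : ℕ} {F : Type} [Field F]

/-- The standard Hermitian form, conjugate-linear in the first variable. -/
def herm (q : ℕ) (u v : Fin 5 → F) : F := ∑ i, u i ^ q * v i

theorem herm_add_right (u v w : Fin 5 → F) : herm q u (v + w) = herm q u v + herm q u w := by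
  simp [herm, mul_add, Finset.sum_add_distrib]

theorem herm_zero_right (u : Fin 5 → F) : herm q u 0 = 0 := by simp [herm]

theorem herm_smul_right (c : F) (u v : Fin 5 → F) : herm q u (c • v) = c * herm q u v := by
  simp only [herm, Finset.mul_sum, Pi.smul_apply, smul_eq_mul]
  exact Finset.sum_congr rfl fun i _ => by ring

theorem herm_sub_right (u v w : Fin 5 → F) : herm q u (v - w) = herm q u v - herm q u w := by
  simp [herm, mul_sub, Finset.sum_sub_distrib]

theorem herm_smul_left (c : F) (u v : Fin 5 → F) : herm q (c • u) v = c ^ q * herm q u v := by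
  simp only [herm, Finset.mul_sum, Pi.smul_apply, smul_eq_mul]
  exact Finset.sum_congr rfl fun i _ => by ring

/-- The linear map whose coordinates are the functionals `herm q (u i)`. -/
def hermMap (q : ℕ) {n : ℕ} (u : Fin n → Fin 5 → F) : (Fin 5 → F) →ₗ[F] (Fin n → F) where
  toFun v i := herm q (u i) v
  map_add' _ _ := funext fun _ => herm_add_right _ _ _
  map_smul' _ _ := funext fun _ => herm_smul_right _ _ _

variable [Fintype F]

namespace IsHermitianField

theorem pow_pow (hF : IsHermitianField q F) (x : F) : (x ^ q) ^ q = x := by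
  rw [← pow_mul, ← sq, ← hF.card_eq, FiniteField.pow_card]

theorem ne_zero (hF : IsHermitianField q F) : q ≠ 0 := by
  have := hF.one_lt
  omega

theorem neg_pow (hF : IsHermitianField q F) (x : F) : (-x) ^ q = -x ^ q := by
  rw [eq_neg_iff_add_eq_zero, ← hF.add_pow, neg_add_cancel, zero_pow hF.ne_zero]

theorem sum_pow (hF : IsHermitianField q F) {ι : Type} (s : Finset ι) (f : ι → F) :
    (∑ i ∈ s, f i) ^ q = ∑ i ∈ s, f i ^ q := by
  classical
  induction s using Finset.induction_on with
  | empty => simp [hF.ne_zero]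
  | insert a s ha ih => rw [Finset.sum_insert ha, Finset.sum_insert ha, hF.add_pow, ih]

theorem card_trace_eq_le [DecidableEq F] (hF : IsHermitianField q F) (t : F) :
    (Finset.univ.filter fun μ : F => μ ^ q + μ = t).card ≤ q := by
  have hdeg : (Polynomial.X ^ q + (Polynomial.X - Polynomial.C t) : Polynomial F).natDegree = q := by
    rw [Polynomial.natDegree_add_eq_left_of_natDegree_lt] <;> simp [hF.one_lt]
  have hne : (Polynomial.X ^ q + (Polynomial.X - Polynomial.C t) : Polynomial F) ≠ 0 := by
    intro h
    rw [h, Polynomial.natDegree_zero] at hdeg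
    exact hF.ne_zero hdeg.symm
  conv_rhs => rw [← hdeg]
  refine Polynomial.card_le_degree_of_subset_roots fun μ hμ => ?_
  rw [Polynomial.mem_roots hne]
  have := (Finset.mem_filter.1 hμ).2
  simp [Polynomial.IsRoot, ← this]

theorem card_fixed_le [DecidableEq F] (hF : IsHermitianField q F) :
    (Finset.univ.filter fun μ : F => μ ^ q = μ).card ≤ q := by
  have hdeg : (Polynomial.X ^ q - Polynomial.X : Polynomial F).natDegree = q := by
    rw [Polynomial.natDegree_sub_eq_left_of_natDegree_lt] <;> simp [hF.one_lt]
  have hne : (Polynomial.X ^ q - Polynomial.X : Polynomial F) ≠ 0 := by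
    intro h
    rw [h, Polynomial.natDegree_zero] at hdeg
    exact hF.ne_zero hdeg.symm
  conv_rhs => rw [← hdeg]
  refine Polynomial.card_le_degree_of_subset_roots fun μ hμ => ?_
  rw [Polynomial.mem_roots hne]
  have := (Finset.mem_filter.1 hμ).2
  simp [Polynomial.IsRoot, this]

theorem card_trace_zero [DecidableEq F] (hF : IsHermitianField q F) :
    (Finset.univ.filter fun μ : F => μ ^ q + μ = 0).card = q := by
  refine le_antisymm (hF.card_trace_eq_le 0) ?_
  set K := Finset.univ.filter fun μ : F => μ ^ q + μ = 0 with hK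
  have hmaps : ∀ x ∈ (Finset.univ : Finset F),
      x ^ q + x ∈ Finset.univ.filter fun μ : F => μ ^ q = μ := fun x _ => by
    simp [hF.add_pow, hF.pow_pow, add_comm]
  have h1 := Finset.card_eq_sum_card_fiberwise hmaps
  have h2 : ∀ t ∈ Finset.univ.filter (fun μ : F => μ ^ q = μ),
      (Finset.univ.filter fun x : F => x ^ q + x = t).card ≤ K.card := fun t _ => by
    rcases (Finset.univ.filter fun x : F => x ^ q + x = t).eq_empty_or_nonempty with h | ⟨x₀, hx₀⟩
    · simp [h]
    · refine Finset.card_le_card_of_injOn (fun x => x - x₀) (fun x hx => ?_)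
        (fun x _ y _ h => sub_left_injective h)
      have hx := (Finset.mem_filter.1 hx).2
      have hx₀ := (Finset.mem_filter.1 hx₀).2
      simp only [hK, Finset.coe_filter, Finset.mem_univ, true_and, Set.mem_ofPred_eq, sub_eq_add_neg,
        hF.add_pow, hF.neg_pow]
      linear_combination hx - hx₀
  have h3 := h1.le.trans (Finset.sum_le_card_nsmul _ _ _ h2)
  rw [Finset.card_univ, hF.card_eq, smul_eq_mul, sq] at h3
  have h4 := h3.trans (Nat.mul_le_mul_right _ hF.card_fixed_le)
  exact Nat.le_of_mul_le_mul_left h4 (Nat.pos_of_ne_zero hF.ne_zero)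

end IsHermitianField

theorem herm_add_left (hF : IsHermitianField q F) (u v w : Fin 5 → F) :
    herm q (u + v) w = herm q u w + herm q v w := by
  simp [herm, hF.add_pow, add_mul, Finset.sum_add_distrib]

theorem herm_sub_left (hF : IsHermitianField q F) (u v w : Fin 5 → F) :
    herm q (u - v) w = herm q u w - herm q v w := by
  simp [herm, sub_eq_add_neg, hF.add_pow, hF.neg_pow, add_mul, Finset.sum_add_distrib]

theorem herm_swap (hF : IsHermitianField q F) (u v : Fin 5 → F) :
    herm q v u = herm q u v ^ q := by
  rw [herm, herm, hF.sum_pow]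
  exact Finset.sum_congr rfl fun i _ => by rw [mul_pow, hF.pow_pow, mul_comm]

theorem herm_swap_eq_zero (hF : IsHermitianField q F) {u v : Fin 5 → F} (h : herm q u v = 0) :
    herm q v u = 0 := by
  rw [herm_swap hF, h, zero_pow hF.ne_zero]

theorem range_hermMap (hF : IsHermitianField q F) {n : ℕ} {u : Fin n → Fin 5 → F}
    (hu : LinearIndependent F u) : LinearMap.range (hermMap q u) = ⊤ := by
  classical
  by_contra hne
  obtain ⟨φ, hφ, hle⟩ := Submodule.exists_le_ker_of_lt_top _ (lt_top_iff_ne_top.2 hne)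
  have hφv : ∀ v, ∑ i, herm q (u i) v * φ (Pi.single i 1) = 0 := fun v => by
    have h : φ (hermMap q u v) = 0 := hle ⟨v, rfl⟩
    rw [LinearMap.pi_apply_eq_sum_univ φ] at h
    have hs : ∀ i : Fin n, (fun j => if i = j then (1 : F) else 0) = Pi.single i 1 := fun i => by
      ext j
      simp [Pi.single_apply, eq_comm]
    simp only [hs] at h
    exact h
  have hsum : ∑ i, φ (Pi.single i 1) ^ q • u i = 0 := by
    funext k
    have h := hφv (Pi.single k 1)
    have h' : ∀ i, herm q (u i) (Pi.single k 1) = u i k ^ q := fun i => by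
      rw [herm, Finset.sum_eq_single k] <;> simp +contextual
    simp only [h'] at h
    have h2 := congrArg (· ^ q) h
    simp only [hF.sum_pow, mul_pow, hF.pow_pow, zero_pow hF.ne_zero] at h2
    rw [Finset.sum_apply, Pi.zero_apply, ← h2]
    exact Finset.sum_congr rfl fun i _ => mul_comm _ _
  have h0 := Fintype.linearIndependent_iff.1 hu _ hsum
  apply hφ
  refine LinearMap.pi_ext' fun i => LinearMap.ext_ring ?_
  have := h0 i
  simpa [hF.ne_zero] using this

theorem finrank_ker_hermMap (hF : IsHermitianField q F) {n : ℕ} {u : Fin n → Fin 5 → F}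
    (hu : LinearIndependent F u) : n + Module.finrank F (LinearMap.ker (hermMap q u)) = 5 := by
  have h := LinearMap.finrank_range_add_finrank_ker (hermMap q u)
  rwa [range_hermMap hF hu, finrank_top, Module.finrank_fin_fun, Module.finrank_fin_fun] at h

theorem not_forall_herm_eq_zero (hF : IsHermitianField q F) {u : Fin 3 → Fin 5 → F}
    (hu : LinearIndependent F u) : ¬ ∀ i j, herm q (u i) (u j) = 0 := by
  intro h
  have h1 := finrank_ker_hermMap hF hu
  have h2 : Submodule.span F (Set.range u) ≤ LinearMap.ker (hermMap q u) := by
    rw [Submodule.span_le]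
    rintro _ ⟨j, rfl⟩
    exact funext fun i => h i j
  have h3 := Submodule.finrank_mono h2
  rw [finrank_span_eq_card hu, Fintype.card_fin] at h3
  omega

theorem not_isotropic_triple (hF : IsHermitianField q F) {u v w : Fin 5 → F}
    (hli : LinearIndependent F ![u, v, w]) (huu : herm q u u = 0) (hvv : herm q v v = 0)
    (hww : herm q w w = 0) (huv : herm q u v = 0) (huw : herm q u w = 0) (hvw : herm q v w = 0) :
    False := by
  refine not_forall_herm_eq_zero hF hli fun i j => ?_
  have hvu := herm_swap_eq_zero hF huv
  have hwu := herm_swap_eq_zero hF huw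
  have hwv := herm_swap_eq_zero hF hvw
  fin_cases i <;> fin_cases j <;> assumption

end HermitianForm

theorem linearIndependent_triple_of_forall {R M : Type*} [Ring R] [AddCommGroup M] [Module R M]
    {u v w : M} (h : ∀ x y z : R, x • u + y • v + z • w = 0 → x = 0 ∧ y = 0 ∧ z = 0) :
    LinearIndependent R ![u, v, w] := by
  rw [Fintype.linearIndependent_iff]
  intro g hg
  rw [Fin.sum_univ_three] at hg
  obtain ⟨h0, h1, h2⟩ := h _ _ _ hg
  intro i
  fin_cases i <;> assumption

section Frame

variable {q d : ℕ} {F : Type} [Field F]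

/-- An isotropic vector `P` together with a hyperbolic pair `a, b` orthogonal to it, such that the
lines spanned by `P` and `a + y b`, for `y ∈ Y`, are generators on which `G` vanishes, and the line
of `P, b` meets the zero set of `G` in `P` only. -/
structure IsFrame (q d : ℕ) (G : MvPolynomial (Fin 5) F) (P a b : Fin 5 → F) (Y : Finset F) :
    Prop where
  ne_zero : P ≠ 0
  herm_PP : herm q P P = 0
  herm_Pa : herm q P a = 0
  herm_Pb : herm q P b = 0
  herm_aa : herm q a a = 0
  herm_bb : herm q b b = 0
  herm_ab : herm q a b = 1
  card_eq : Y.card = d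
  trace_eq_zero : ∀ y ∈ Y, y ^ q + y = 0
  eval_eq_zero : ∀ y ∈ Y, ∀ s t : F, eval (s • P + t • (a + y • b)) G = 0
  eval_ne_zero : ∀ z : F, eval (b + z • P) G ≠ 0

/-- The projection of `u` along `P` to the orthogonal complement of `v`, when `herm q v P = 1`. -/
def perpPart (q : ℕ) (P v u : Fin 5 → F) : Fin 5 → F := u - herm q v u • P

theorem perpPart_add_smul (P v u u' : Fin 5 → F) (y : F) :
    perpPart q P v (u + y • u') = perpPart q P v u + y • perpPart q P v u' := by
  simp only [perpPart, herm_add_right, herm_smul_right]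
  module

namespace IsFrame

variable {G : MvPolynomial (Fin 5) F} {P a b : Fin 5 → F} {Y : Finset F}

theorem herm_P_add_smul (fr : IsFrame q d G P a b Y) (y : F) : herm q P (a + y • b) = 0 := by
  simp [herm_add_right, herm_smul_right, fr.herm_Pa, fr.herm_Pb]

theorem eval_perpPart_add_smul (fr : IsFrame q d G P a b Y) {y : F} (hy : y ∈ Y) (v : Fin 5 → F)
    (s t : F) : eval (s • perpPart q P v (a + y • b) + t • P) G = 0 := by
  have h := fr.eval_eq_zero y hy (t - s * herm q v (a + y • b)) s
  rw [← h, perpPart]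
  congr 2
  module

end IsFrame

/-- The isotropic vectors `v` with `herm q P v = 1`. -/
def affineCone (q : ℕ) [Fintype F] [DecidableEq F] (P : Fin 5 → F) : Finset (Fin 5 → F) :=
  Finset.univ.filter fun v => herm q P v = 1 ∧ herm q v v = 0

theorem mem_affineCone [Fintype F] [DecidableEq F] {P v : Fin 5 → F} :
    v ∈ affineCone q P ↔ herm q P v = 1 ∧ herm q v v = 0 := by
  simp [affineCone]

theorem herm_perpPart_right {P u w : Fin 5 → F} (v : Fin 5 → F) (hwP : herm q w P = 0) :
    herm q w (perpPart q P v u) = herm q w u := by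
  rw [perpPart, herm_sub_right, herm_smul_right, hwP, mul_zero, sub_zero]

variable [Fintype F]

theorem herm_perpPart_left (hF : IsHermitianField q F) {P u w : Fin 5 → F} (v : Fin 5 → F)
    (hPw : herm q P w = 0) : herm q (perpPart q P v u) w = herm q u w := by
  rw [perpPart, herm_sub_left hF, herm_smul_left, hPw, mul_zero, sub_zero]

theorem herm_perpPart_self (hF : IsHermitianField q F) {P u v : Fin 5 → F}
    (hv : herm q P v = 1) : herm q v (perpPart q P v u) = 0 := by
  rw [perpPart, herm_sub_right, herm_smul_right, herm_swap hF P v, hv, one_pow, mul_one,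
    sub_self]

theorem perpPart_add_smul_perpPart (hF : IsHermitianField q F) {P u u' : Fin 5 → F}
    (hPu' : herm q P u' = 0) (v : Fin 5 → F) (c : F) :
    perpPart q P (v + c • perpPart q P v u) u' =
      perpPart q P v u' - (c ^ q * herm q u u') • P := by
  simp only [perpPart, herm_add_left hF, herm_smul_left, herm_sub_left hF, hPu']
  module

theorem perpPart_add_smul_self (hF : IsHermitianField q F) {P u : Fin 5 → F}
    (hPu : herm q P u = 0) (v : Fin 5 → F) (c : F) :
    perpPart q P (v + c • P) u = perpPart q P v u := by
  simp [perpPart, herm_add_left hF, herm_smul_left, hPu]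

theorem IsFrame.herm_add_smul_self {G : MvPolynomial (Fin 5) F}
    {P a b : Fin 5 → F} {Y : Finset F} (hF : IsHermitianField q F) (fr : IsFrame q d G P a b Y)
    {y : F} (hy : y ∈ Y) : herm q (a + y • b) (a + y • b) = 0 := by
  have hba : herm q b a = 1 := by rw [herm_swap hF a b, fr.herm_ab, one_pow]
  simp only [herm_add_right, herm_add_left hF, herm_smul_right, herm_smul_left, fr.herm_aa,
    fr.herm_bb, fr.herm_ab, hba]
  linear_combination fr.trace_eq_zero y hy

variable [DecidableEq F]

theorem add_perpPart_mem_affineCone (hF : IsHermitianField q F) {P u v : Fin 5 → F}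
    (hPP : herm q P P = 0) (hPu : herm q P u = 0) (huu : herm q u u = 0)
    (hv : v ∈ affineCone q P) (c : F) : v + c • perpPart q P v u ∈ affineCone q P := by
  obtain ⟨h1, h2⟩ := mem_affineCone.1 hv
  have h3 := herm_perpPart_self hF (u := u) h1
  have h4 : herm q P (perpPart q P v u) = 0 := by rw [herm_perpPart_right v hPP, hPu]
  have h5 : herm q (perpPart q P v u) (perpPart q P v u) = 0 := by
    rw [herm_perpPart_left hF v h4, herm_perpPart_right v (herm_swap_eq_zero hF hPu), huu]
  rw [mem_affineCone]
  simp [herm_add_right, herm_add_left hF, herm_smul_right, herm_smul_left, h1, h2, h3, h4, h5,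
    herm_swap_eq_zero hF h3]

theorem add_smul_mem_affineCone (hF : IsHermitianField q F) {P v : Fin 5 → F}
    (hPP : herm q P P = 0) (hv : v ∈ affineCone q P) {μ : F} (hμ : μ ^ q + μ = 0) :
    v + μ • P ∈ affineCone q P := by
  obtain ⟨h1, h2⟩ := mem_affineCone.1 hv
  have h3 : herm q v P = 1 := by rw [herm_swap hF, h1, one_pow]
  rw [mem_affineCone]
  simp only [herm_add_right, herm_add_left hF, herm_smul_right, herm_smul_left, h1, h2, h3, hPP]
  constructor
  · ring
  · linear_combination hμ

theorem sum_affineCone_add_perpPart (hF : IsHermitianField q F) {P u : Fin 5 → F}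
    (hPP : herm q P P = 0) (hPu : herm q P u = 0) (huu : herm q u u = 0) (c : F)
    (f : (Fin 5 → F) → ℕ) :
    ∑ v ∈ affineCone q P, f (v + c • perpPart q P v u) = ∑ v ∈ affineCone q P, f v := by
  refine Finset.sum_nbij' (fun v => v + c • perpPart q P v u)
    (fun v => v + (-c) • perpPart q P v u)
    (fun v hv => add_perpPart_mem_affineCone hF hPP hPu huu hv _)
    (fun v hv => add_perpPart_mem_affineCone hF hPP hPu huu hv _) (fun v _ => ?_) (fun v _ => ?_)
    (fun v _ => rfl) <;>
  · simp only [perpPart_add_smul_perpPart hF hPu, huu]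
    module

theorem sum_affineCone_add_smul (hF : IsHermitianField q F) {P : Fin 5 → F}
    (hPP : herm q P P = 0) {μ : F} (hμ : μ ^ q + μ = 0) (f : (Fin 5 → F) → ℕ) :
    ∑ v ∈ affineCone q P, f (v + μ • P) = ∑ v ∈ affineCone q P, f v := by
  refine Finset.sum_nbij' (fun v => v + μ • P) (fun v => v + (-μ) • P)
    (fun v hv => add_smul_mem_affineCone hF hPP hv hμ)
    (fun v hv => add_smul_mem_affineCone hF hPP hv ?_) (fun v _ => by module)
    (fun v _ => by module) (fun v _ => rfl)
  rw [hF.neg_pow]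
  linear_combination -hμ

theorem card_affineCone_le (hF : IsHermitianField q F) {P : Fin 5 → F} (hP : P ≠ 0)
    (hPP : herm q P P = 0) : (affineCone q P).card ≤ q ^ 7 := by
  set H := Finset.univ.filter fun v : Fin 5 → F => herm q P v = 1 with hH
  have hHcard : H.card ≤ q ^ 8 := by
    rcases H.eq_empty_or_nonempty with h | ⟨v₀, hv₀⟩
    · simp [h]
    · have h0 : herm q P v₀ = 1 := (Finset.mem_filter.1 hv₀).2
      have hli : LinearIndependent F ![P] := LinearIndependent.of_subsingleton 0 hP
      have hk := finrank_ker_hermMap hF hli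
      have hc : Nat.card (LinearMap.ker (hermMap q ![P])) = q ^ 8 := by
        rw [Module.natCard_eq_pow_finrank (K := F), Nat.card_eq_fintype_card, hF.card_eq,
          show Module.finrank F (LinearMap.ker (hermMap q ![P])) = 4 by omega, ← pow_mul]
      have := Fintype.ofFinite (LinearMap.ker (hermMap q ![P]))
      rw [← hc, Nat.card_eq_fintype_card, ← Finset.card_univ]
      have hmem : ∀ v ∈ H, v - v₀ ∈ LinearMap.ker (hermMap q ![P]) := fun v hv => by
        refine funext fun i => ?_
        fin_cases i
        change herm q P (v - v₀) = 0
        rw [herm_sub_right, (Finset.mem_filter.1 hv).2, h0, sub_self]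
      refine Finset.card_le_card_of_injOn
        (fun v => if hv : v ∈ H then ⟨v - v₀, hmem v hv⟩ else 0) (fun _ _ => by simp) ?_
      intro v hv w hw h
      simp only [Finset.mem_coe] at hv hw
      simpa [hv, hw] using h
  have hfib : (affineCone q P ×ˢ (Finset.univ : Finset F)).card ≤ q * H.card := by
    refine Finset.card_le_mul_card_image_of_maps_to (f := fun x => x.1 + x.2 • P) ?_ q ?_
    · rintro ⟨v, c⟩ hv
      have hv := mem_affineCone.1 (Finset.mem_product.1 hv).1
      simp [hH, herm_add_right, herm_smul_right, hPP, hv.1]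
    · intro w hw
      have hw : herm q P w = 1 := (Finset.mem_filter.1 hw).2
      have hw' : herm q w P = 1 := by rw [herm_swap hF, hw, one_pow]
      refine le_trans (Finset.card_le_card_of_injOn Prod.snd ?_ ?_)
        (hF.card_trace_eq_le (herm q w w))
      · rintro ⟨v, c⟩ hx
        obtain ⟨hx, hvw⟩ := Finset.mem_filter.1 hx
        obtain ⟨h1, h2⟩ := mem_affineCone.1 (Finset.mem_product.1 hx).1
        have h3 : herm q v P = 1 := by rw [herm_swap hF, h1, one_pow]
        simp only at hvw h1 h2 h3
        simp only [Finset.coe_filter, Finset.mem_univ, true_and, Set.mem_ofPred_eq, ← hvw,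
          herm_add_right, herm_add_left hF, herm_smul_right, herm_smul_left, h1, h2, h3, hPP]
        ring
      · rintro ⟨v, c⟩ hx ⟨v', c'⟩ hx' h
        have h1 := (Finset.mem_filter.1 hx).2
        have h2 := (Finset.mem_filter.1 hx').2
        simp only at h h1 h2
        subst h
        rw [← h2] at h1
        rw [add_right_cancel h1]
  rw [Finset.card_product, Finset.card_univ, hF.card_eq] at hfib
  have h1 := hfib.trans (Nat.mul_le_mul_left q hHcard)
  have h2 : 0 < q ^ 2 := pow_pos (by have := hF.one_lt; omega) 2
  refine Nat.le_of_mul_le_mul_right (c := q ^ 2) ?_ h2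
  calc _ ≤ _ := h1
    _ = _ := by ring

end Frame

section AffineConeZeros

variable {q d : ℕ} {F : Type} [Field F] [Fintype F] [DecidableEq F]
  {G : MvPolynomial (Fin 5) F} {P a b : Fin 5 → F} {Y : Finset F}

/-- The points `v` of the affine cone such that `G` vanishes on the line through `v` in the
direction of the projection of `u`. -/
def ruledPart (q : ℕ) (G : MvPolynomial (Fin 5) F) (P u : Fin 5 → F) : Finset (Fin 5 → F) :=
  (affineCone q P).filter fun v => ∀ c : F, eval (v + c • perpPart q P v u) G = 0

namespace IsFrame

theorem sum_card_filter_mem_ruledPart_le (hF : IsHermitianField q F) (hG : G.IsHomogeneous d)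
    (hd : d + 1 < q ^ 2) (fr : IsFrame q d G P a b Y) (v : Fin 5 → F) :
    ∑ t : F, (Y.filter fun y =>
      v + t • perpPart q P v b ∈ ruledPart q G P (a + y • b)).card ≤ d := by
  rw [← hF.card_eq] at hd
  have htd := hG.totalDegree_le
  refine sum_le_of_le_order (v := v) (B := perpPart q P v b) htd ?_ _ fun t j hj => ?_
  · intro h
    have h1 := coeff_lineRestr_top hG hd v (perpPart q P v b)
    rw [h, Polynomial.coeff_zero] at h1
    refine fr.eval_ne_zero (-herm q v b) ?_
    rw [h1, perpPart, neg_smul, sub_eq_add_neg]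
  · refine coeff_lineRestr_eq_zero (A := perpPart q P (v + t • perpPart q P v b) a)
      (by omega) (fun y hy s => ?_) hj
    have h := (Finset.mem_filter.1 (Finset.mem_filter.1 hy).2).2 s
    rw [perpPart_add_smul, perpPart_add_smul_perpPart hF fr.herm_Pb (u' := b), fr.herm_bb, mul_zero,
      zero_smul, sub_zero] at h
    exact h

theorem exists_card_ruledPart_le (hF : IsHermitianField q F) (hG : G.IsHomogeneous d)
    (hd0 : 0 < d) (hd : d + 1 < q ^ 2) (fr : IsFrame q d G P a b Y) :
    ∃ y ∈ Y, q ^ 2 * (ruledPart q G P (a + y • b)).card ≤ (affineCone q P).card := by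
  refine Finset.exists_le_of_sum_le (Finset.card_pos.1 (by rwa [fr.card_eq])) ?_
  rw [Finset.sum_const, fr.card_eq, smul_eq_mul]
  have h1 := Finset.sum_le_card_nsmul (affineCone q P) _ d fun v _ =>
    fr.sum_card_filter_mem_ruledPart_le hF hG hd v
  rw [smul_eq_mul, mul_comm] at h1
  refine le_trans (le_of_eq ?_) h1
  rw [Finset.sum_comm]
  have h2 : ∀ t : F, ∑ v ∈ affineCone q P, (Y.filter fun y =>
      v + t • perpPart q P v b ∈ ruledPart q G P (a + y • b)).card =
      ∑ y ∈ Y, (ruledPart q G P (a + y • b)).card := fun t => by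
    rw [sum_affineCone_add_perpPart hF fr.herm_PP fr.herm_Pb fr.herm_bb t
      (fun v => (Y.filter fun y => v ∈ ruledPart q G P (a + y • b)).card)]
    simp only [Finset.card_filter]
    rw [Finset.sum_comm]
    refine Finset.sum_congr rfl fun y _ => ?_
    rw [← Finset.card_filter]
    congr 1
    ext v
    simp [ruledPart]
  rw [Finset.sum_congr rfl fun t _ => h2 t, Finset.sum_const, Finset.card_univ, hF.card_eq,
    smul_eq_mul, Finset.mul_sum]

theorem card_zeros_add_card_ruled_lt (hF : IsHermitianField q F) (hG : G.IsHomogeneous d)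
    (hd : d + 1 < q ^ 2) (fr : IsFrame q d G P a b Y) {y : F} (hy : y ∈ Y) {v : Fin 5 → F}
    (hv : v ∈ affineCone q P) (hvn : v ∉ ruledPart q G P (a + y • b)) :
    (Finset.univ.filter fun c : F => eval (v + c • perpPart q P v (a + y • b)) G = 0).card +
      (Finset.univ.filter fun μ : F =>
        μ ^ q + μ = 0 ∧ v + μ • P ∈ ruledPart q G P (a + y • b)).card < d := by
  rw [← hF.card_eq] at hd
  set D := perpPart q P v (a + y • b) with hD
  set M := Finset.univ.filter fun μ : F =>
        μ ^ q + μ = 0 ∧ v + μ • P ∈ ruledPart q G P (a + y • b) with hM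
  have hM0 : (0 : F) ∉ M := fun h => hvn (by simpa using (Finset.mem_filter.1 h).2.2)
  have hne : ∃ t : F, eval (v + t • D) G ≠ 0 := by
    by_contra! h
    exact hvn (Finset.mem_filter.2 ⟨hv, h⟩)
  have hcard : (insert 0 (M.image fun μ => μ⁻¹)).card = M.card + 1 := by
    rw [Finset.card_insert_of_notMem, Finset.card_image_of_injective _ inv_injective]
    simpa using hM0
  have := card_zeros_add_card_le hG hd (v := v) (B := D) (A := P)
    (Y := insert 0 (M.image fun μ => μ⁻¹)) ?_ hne
  · omega
  intro z hz s
  rcases Finset.mem_insert.1 hz with rfl | hz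
  · have h := fr.eval_perpPart_add_smul hy v 1 s
    rwa [one_smul, ← hD, ← add_zero P, ← zero_smul F v] at h
  obtain ⟨μ, hμ, rfl⟩ := Finset.mem_image.1 hz
  have hμ0 : μ ≠ 0 := fun h => hM0 (h ▸ hμ)
  by_cases hs : s = 0
  · have h := fr.eval_perpPart_add_smul hy v 1 0
    rw [one_smul, ← hD, zero_smul, add_zero] at h
    rwa [hs, zero_smul, add_zero]
  have h := (Finset.mem_filter.1 (Finset.mem_filter.1 hμ).2.2).2 (μ / s)
  rw [perpPart_add_smul_self hF (fr.herm_P_add_smul y), ← hD] at h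
  have h2 : D + s • (P + μ⁻¹ • v) = (s / μ) • (v + μ • P + (μ / s) • D) := by
    rw [smul_add, smul_add, smul_add, smul_smul, smul_smul, smul_smul, div_mul_div_cancel₀ hμ0,
      div_self hs, div_mul_cancel₀ _ hμ0, one_smul, div_eq_mul_inv]
    abel
  rw [h2, eval_smul_of_isHomogeneous hG, h, mul_zero]

theorem exists_notMem_ruledPart (hF : IsHermitianField q F) (hG : G.IsHomogeneous d)
    (hdq : d ≤ q) (hd : d + 1 < q ^ 2) (fr : IsFrame q d G P a b Y)
    (hpl : ∀ u v w : Fin 5 → F, LinearIndependent F ![u, v, w] →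
      ∃ α β γ : F, eval (α • u + β • v + γ • w) G ≠ 0)
    {y : F} (hy : y ∈ Y) {v : Fin 5 → F} (hv : v ∈ affineCone q P) :
    ∃ μ : F, μ ^ q + μ = 0 ∧ v + μ • P ∉ ruledPart q G P (a + y • b) := by
  by_contra! h
  rw [← hF.card_eq] at hd
  set D := perpPart q P v (a + y • b) with hD
  have hvanish : ∀ β γ : F, eval (v + β • D + γ • P) G = 0 := fun β => by
    have hP : eval P G = 0 := by simpa using fr.eval_eq_zero y hy 1 0
    have htop := coeff_lineRestr_top hG hd (v + β • D) P
    have hdeg := natDegree_lineRestr_le hG.totalDegree_le (v + β • D) P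
    have hz : lineRestr G (v + β • D) P = 0 := by
      by_contra hne
      have hlt : (lineRestr G (v + β • D) P).natDegree < d := by
        refine lt_of_le_of_ne hdeg fun h' => hne ?_
        rw [← Polynomial.leadingCoeff_eq_zero, Polynomial.leadingCoeff, h', htop, hP]
      refine hne (Polynomial.eq_zero_of_natDegree_lt_card_of_eval_eq_zero' _
        (Finset.univ.filter fun μ : F => μ ^ q + μ = 0) (fun μ hμ => ?_) ?_)
      · have h1 := (Finset.mem_filter.1 (h μ (Finset.mem_filter.1 hμ).2)).2 β
        rw [perpPart_add_smul_self hF (fr.herm_P_add_smul y), ← hD] at h1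
        rw [eval_lineRestr, ← h1, add_right_comm]
      · rw [hF.card_trace_zero]
        omega
    intro γ
    rw [← eval_lineRestr, hz, Polynomial.eval_zero]
  have hv1 := (mem_affineCone.1 hv).1
  have hPD : herm q P D = 0 := by
    rw [hD, herm_perpPart_right v fr.herm_PP, fr.herm_P_add_smul]
  have hbD : herm q b D = 1 := by
    rw [hD, herm_perpPart_right v (herm_swap_eq_zero hF fr.herm_Pb)]
    simp [herm_add_right, herm_smul_right, fr.herm_bb, herm_swap hF a b, fr.herm_ab]
  have hli : LinearIndependent F ![v, D, P] := by
    refine linearIndependent_triple_of_forall fun x y z h0 => ?_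
    have hx : x = 0 := by
      simpa [herm_add_right, herm_smul_right, hv1, hPD, fr.herm_PP, herm_zero_right]
        using congrArg (herm q P) h0
    rw [hx, zero_smul, zero_add] at h0
    have hy : y = 0 := by
      simpa [herm_add_right, herm_smul_right, hbD, herm_swap_eq_zero hF fr.herm_Pb,
        herm_zero_right] using congrArg (herm q b) h0
    rw [hy, zero_smul, zero_add] at h0
    exact ⟨hx, hy, (smul_eq_zero.1 h0).resolve_right fr.ne_zero⟩
  obtain ⟨α, β, γ, hne⟩ := hpl v D P hli
  refine hne ?_
  by_cases hα : α = 0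
  · rw [hα, zero_smul, zero_add]
    exact fr.eval_perpPart_add_smul hy v β γ
  · have h2 : α • v + β • D + γ • P = α • (v + (β / α) • D + (γ / α) • P) := by
      rw [smul_add, smul_add, smul_smul, smul_smul, mul_div_cancel₀ _ hα, mul_div_cancel₀ _ hα]
    rw [h2, eval_smul_of_isHomogeneous hG, hvanish, mul_zero]

end IsFrame

end AffineConeZeros

section AffineConeCount

variable {q d : ℕ} {F : Type} [Field F] [Fintype F] [DecidableEq F]
  {G : MvPolynomial (Fin 5) F} {P a b : Fin 5 → F} {Y : Finset F}

/-- The number of zeros of `G` on the affine line through `v` in the direction of the projection of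
`u`. -/
def zerosOnLine (q : ℕ) (G : MvPolynomial (Fin 5) F) (P u v : Fin 5 → F) : ℕ :=
  (Finset.univ.filter fun c : F => eval (v + c • perpPart q P v u) G = 0).card

/-- The number of translates of `v` by trace zero multiples of `P` that lie in `ruledPart`. -/
def ruledTranslates (q : ℕ) (G : MvPolynomial (Fin 5) F) (P u v : Fin 5 → F) : ℕ :=
  (Finset.univ.filter fun μ : F => μ ^ q + μ = 0 ∧ v + μ • P ∈ ruledPart q G P u).card

theorem ruledTranslates_add_smul (hF : IsHermitianField q F) (u v : Fin 5 → F) {μ : F}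
    (hμ : μ ^ q + μ = 0) : ruledTranslates q G P u (v + μ • P) = ruledTranslates q G P u v := by
  refine Finset.card_nbij' (fun x => μ + x) (fun x => -μ + x) (fun x hx => ?_) (fun x hx => ?_)
    (fun x _ => neg_add_cancel_left μ x) (fun x _ => add_neg_cancel_left μ x)
  · simp only [Finset.coe_filter, Finset.mem_univ, true_and, Set.mem_ofPred_eq] at hx ⊢
    rw [add_assoc, ← add_smul] at hx
    rw [hF.add_pow]
    exact ⟨by linear_combination hx.1 + hμ, hx.2⟩
  · simp only [Finset.coe_filter, Finset.mem_univ, true_and, Set.mem_ofPred_eq] at hx ⊢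
    rw [add_assoc, ← add_smul, add_neg_cancel_left, hF.add_pow, hF.neg_pow]
    exact ⟨by linear_combination hx.1 - hμ, hx.2⟩

namespace IsFrame

theorem sum_zerosOnLine_add_le (hF : IsHermitianField q F) (hG : G.IsHomogeneous d)
    (hdq : d ≤ q) (hd : d + 1 < q ^ 2) (fr : IsFrame q d G P a b Y)
    (hpl : ∀ u v w : Fin 5 → F, LinearIndependent F ![u, v, w] →
      ∃ α β γ : F, eval (α • u + β • v + γ • w) G ≠ 0)
    {y : F} (hy : y ∈ Y) {v : Fin 5 → F} (hv : v ∈ affineCone q P) :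
    ∑ μ : F with μ ^ q + μ = 0, zerosOnLine q G P (a + y • b) (v + μ • P) +
      (q + q * ruledTranslates q G P (a + y • b) v) ≤
        q * d + q ^ 2 * ruledTranslates q G P (a + y • b) v := by
  set u := a + y • b with hu
  set k := ruledTranslates q G P u v with hk
  set K := Finset.univ.filter fun μ : F => μ ^ q + μ = 0 with hK
  have hKcard : K.card = q := hF.card_trace_zero
  have hin : (K.filter fun μ => v + μ • P ∈ ruledPart q G P u).card = k := by
    rw [hK, Finset.filter_filter, hk, ruledTranslates]
  have hout : (K.filter fun μ => v + μ • P ∉ ruledPart q G P u).card + k = q := by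
    rw [← hin, ← hKcard, add_comm]
    exact Finset.card_filter_add_card_filter_not _
  have hlt : ∀ μ ∈ K, v + μ • P ∉ ruledPart q G P u →
      zerosOnLine q G P u (v + μ • P) + k + 1 ≤ d := fun μ hμ hn => by
    have hμ := (Finset.mem_filter.1 hμ).2
    have := fr.card_zeros_add_card_ruled_lt hF hG hd hy
      (add_smul_mem_affineCone hF fr.herm_PP hv hμ) hn
    rw [hk, ← ruledTranslates_add_smul hF u v hμ]
    exact this
  have hkd : k + 1 ≤ d := by
    obtain ⟨μ, hμ, hn⟩ := fr.exists_notMem_ruledPart hF hG hdq hd hpl hy hv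
    have := hlt μ (Finset.mem_filter.2 ⟨Finset.mem_univ _, hμ⟩) hn
    omega
  have h1 : ∑ μ ∈ K with v + μ • P ∈ ruledPart q G P u,
      zerosOnLine q G P u (v + μ • P) ≤ k * q ^ 2 := by
    rw [← hin, ← smul_eq_mul]
    refine Finset.sum_le_card_nsmul _ _ _ fun μ _ => ?_
    rw [← hF.card_eq]
    exact Finset.card_le_univ _
  have h2 : ∑ μ ∈ K with v + μ • P ∉ ruledPart q G P u,
      (zerosOnLine q G P u (v + μ • P) + k + 1) ≤
        (K.filter fun μ => v + μ • P ∉ ruledPart q G P u).card * d := by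
    rw [← smul_eq_mul]
    exact Finset.sum_le_card_nsmul _ _ _ fun μ hμ =>
      hlt μ (Finset.mem_filter.1 hμ).1 (Finset.mem_filter.1 hμ).2
  simp only [add_assoc _ k 1, Finset.sum_add_distrib, Finset.sum_const, smul_eq_mul] at h2
  rw [← Finset.sum_filter_add_sum_filter_not K (fun μ => v + μ • P ∈ ruledPart q G P u)]
  clear_value k
  generalize (K.filter fun μ => v + μ • P ∉ ruledPart q G P u).card = m at hout h2
  nlinarith

theorem sum_zerosOnLine (hF : IsHermitianField q F) (fr : IsFrame q d G P a b Y) {y : F}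
    (hy : y ∈ Y) : ∑ v ∈ affineCone q P, zerosOnLine q G P (a + y • b) v =
      q ^ 2 * ((affineCone q P).filter fun v => eval v G = 0).card := by
  simp only [zerosOnLine, Finset.card_filter]
  rw [Finset.sum_comm, Finset.sum_congr rfl fun c _ =>
    sum_affineCone_add_perpPart hF fr.herm_PP (fr.herm_P_add_smul y)
      (fr.herm_add_smul_self hF hy) c (fun v => if eval v G = 0 then 1 else 0),
    Finset.sum_const, Finset.card_univ, hF.card_eq, smul_eq_mul]

theorem sum_sum_zerosOnLine_add_smul (hF : IsHermitianField q F) (fr : IsFrame q d G P a b Y)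
    (u : Fin 5 → F) :
    ∑ v ∈ affineCone q P, ∑ μ : F with μ ^ q + μ = 0, zerosOnLine q G P u (v + μ • P) =
      q * ∑ v ∈ affineCone q P, zerosOnLine q G P u v := by
  rw [Finset.sum_comm, Finset.sum_congr rfl fun μ hμ => sum_affineCone_add_smul hF fr.herm_PP
    (Finset.mem_filter.1 hμ).2 _, Finset.sum_const, hF.card_trace_zero, smul_eq_mul]

theorem sum_ruledTranslates (hF : IsHermitianField q F) (fr : IsFrame q d G P a b Y)
    (u : Fin 5 → F) :
    ∑ v ∈ affineCone q P, ruledTranslates q G P u v = q * (ruledPart q G P u).card := by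
  have h : (affineCone q P).filter (fun v => v ∈ ruledPart q G P u) = ruledPart q G P u := by
    ext v
    simp [ruledPart]
  simp only [ruledTranslates, ← Finset.filter_filter]
  simp only [Finset.card_filter _ (Finset.filter _ _)]
  rw [Finset.sum_comm, Finset.sum_congr rfl fun μ hμ => sum_affineCone_add_smul hF fr.herm_PP
    (Finset.mem_filter.1 hμ).2 (fun v => if v ∈ ruledPart q G P u then 1 else 0),
    Finset.sum_const, hF.card_trace_zero, smul_eq_mul, ← Finset.card_filter, h]

theorem card_affineCone_zeros_add_le (hF : IsHermitianField q F) (hG : G.IsHomogeneous d)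
    (hd1 : 1 < d) (hdq : d ≤ q) (fr : IsFrame q d G P a b Y)
    (hpl : ∀ u v w : Fin 5 → F, LinearIndependent F ![u, v, w] →
      ∃ α β γ : F, eval (α • u + β • v + γ • w) G ≠ 0) :
    ((affineCone q P).filter fun v => eval v G = 0).card + q ^ 4 ≤ d * q ^ 5 := by
  have hq : 0 < q := by omega
  have hd : d + 1 < q ^ 2 := by nlinarith
  obtain ⟨y, hy, hR⟩ := fr.exists_card_ruledPart_le hF hG (by omega) hd
  have hA := card_affineCone_le hF fr.ne_zero fr.herm_PP
  have h := Finset.sum_le_sum fun v hv => fr.sum_zerosOnLine_add_le hF hG hdq hd hpl hy (v := v) hv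
  simp only [Finset.sum_add_distrib, ← Finset.mul_sum, Finset.sum_const, smul_eq_mul,
    fr.sum_sum_zerosOnLine_add_smul hF, fr.sum_zerosOnLine hF hy, fr.sum_ruledTranslates hF] at h
  generalize ((affineCone q P).filter fun v => eval v G = 0).card = z at *
  generalize (ruledPart q G P (a + y • b)).card = r at *
  generalize (affineCone q P).card = n at *
  have h' : q ^ 2 * z + n + q * r ≤ d * n + q ^ 2 * r := by
    refine Nat.le_of_mul_le_mul_left (c := q) ?_ hq
    nlinarith
  have hr : r ≤ q ^ 5 := by
    refine Nat.le_of_mul_le_mul_left (c := q ^ 2) ?_ (by positivity)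
    calc _ ≤ _ := hR.trans hA
      _ = _ := by ring
  refine Nat.le_of_mul_le_mul_left (c := q ^ 2) ?_ (by positivity)
  zify at *
  have h1 : (0 : ℤ) ≤ (d - 1) * (q ^ 7 - n) := mul_nonneg (by linarith) (by linarith)
  have h2 : (0 : ℤ) ≤ (q ^ 2 - q) * (q ^ 5 - r) := mul_nonneg (by nlinarith) (by linarith)
  nlinarith

end IsFrame

end AffineConeCount

section PlaneRestriction

variable {ι F : Type} [Field F]

/-- The polynomial `G (u + x v + y w)` in the variables `x` and `y`. -/
def planeRestr (G : MvPolynomial ι F) (u v w : ι → F) : MvPolynomial (Fin 2) F :=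
  aeval (fun i => C (u i) + C (v i) * X 0 + C (w i) * X 1) G

theorem eval_planeRestr (G : MvPolynomial ι F) (u v w : ι → F) (p : Fin 2 → F) :
    eval p (planeRestr G u v w) = eval (u + p 0 • v + p 1 • w) G := by
  have h : ((aeval p : MvPolynomial (Fin 2) F →ₐ[F] F).comp
      (aeval (fun i => C (u i) + C (v i) * X 0 + C (w i) * X 1))) =
      (aeval (u + p 0 • v + p 1 • w) : MvPolynomial ι F →ₐ[F] F) := by
    ext i
    simp [mul_comm]
  exact DFunLike.congr_fun h G

theorem aeval_planeRestr (G : MvPolynomial ι F) (u v w : ι → F) :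
    aeval ![0, Polynomial.X] (planeRestr G u v w) = lineRestr G u w := by
  have h : ((aeval ![0, Polynomial.X] : MvPolynomial (Fin 2) F →ₐ[F] Polynomial F).comp
      (aeval (fun i => C (u i) + C (v i) * X 0 + C (w i) * X 1))) =
      (aeval (fun i => Polynomial.C (u i) + Polynomial.C (w i) * Polynomial.X) :
        MvPolynomial ι F →ₐ[F] Polynomial F) := by
    ext1 i
    simp [Polynomial.algebraMap_eq]
  exact DFunLike.congr_fun h G

theorem totalDegree_planeRestr_le {G : MvPolynomial ι F} {d : ℕ} (hG : G.totalDegree ≤ d)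
    (u v w : ι → F) : (planeRestr G u v w).totalDegree ≤ d := by
  rw [planeRestr, aeval_def, eval₂_eq]
  refine totalDegree_finsetSum_le fun m hm => ?_
  have hlin : ∀ i, (C (u i) + C (v i) * X 0 + C (w i) * X 1 :
      MvPolynomial (Fin 2) F).totalDegree ≤ 1 := fun i => by
    refine (totalDegree_add _ _).trans (max_le ((totalDegree_add _ _).trans (max_le ?_ ?_)) ?_)
    · simp
    · exact (totalDegree_mul _ _).trans (by simp)
    · exact (totalDegree_mul _ _).trans (by simp)
  refine (totalDegree_mul _ _).trans ?_
  rw [algebraMap_eq, totalDegree_C, zero_add]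
  refine (totalDegree_finsetProd _ _).trans (le_trans ?_ ((le_totalDegree hm).trans hG))
  exact Finset.sum_le_sum fun i _ => (totalDegree_pow _ _).trans
    ((Nat.mul_le_mul_left _ (hlin i)).trans (mul_one _).le)

theorem coeff_aeval_zero_X (f : MvPolynomial (Fin 2) F) (n : ℕ) :
    (aeval ![0, (Polynomial.X : Polynomial F)] f).coeff n = coeff (Finsupp.single 1 n) f := by
  induction f using MvPolynomial.induction_on' with
  | monomial m c =>
    rw [aeval_monomial, coeff_monomial, Finsupp.prod_fintype _ _ (fun _ => pow_zero _),
      Fin.prod_univ_two, Polynomial.algebraMap_eq, Polynomial.coeff_C_mul]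
    have h : m = Finsupp.single 1 n ↔ m 0 = 0 ∧ m 1 = n := by
      simp [Finsupp.ext_iff, Fin.forall_fin_two]
    by_cases h0 : m 0 = 0
    · simp [h, h0, Polynomial.coeff_X_pow, eq_comm]
    · simp [h, h0]
  | add p q hp hq => rw [map_add, Polynomial.coeff_add, hp, hq, coeff_add]

end PlaneRestriction

section TangentCone

variable {q d : ℕ} {F : Type} [Field F] [Fintype F]
  {G : MvPolynomial (Fin 5) F} {P a b : Fin 5 → F} {Y : Finset F}

namespace IsFrame

theorem linearIndependent (fr : IsFrame q d G P a b Y) (hF : IsHermitianField q F) :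
    LinearIndependent F ![P, a, b] := by
  refine linearIndependent_triple_of_forall fun x y z h => ?_
  have hz : z = 0 := by
    simpa [herm_add_right, herm_smul_right, herm_zero_right, fr.herm_aa, fr.herm_ab,
      herm_swap_eq_zero hF fr.herm_Pa] using congrArg (herm q a) h
  have hy : y = 0 := by
    simpa [herm_add_right, herm_smul_right, herm_zero_right, fr.herm_bb, fr.herm_ab,
      herm_swap hF a b, herm_swap_eq_zero hF fr.herm_Pb] using congrArg (herm q b) h
  rw [hy, hz, zero_smul, zero_smul, add_zero, add_zero] at h
  exact ⟨(smul_eq_zero.1 h).resolve_right fr.ne_zero, hy, hz⟩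

theorem exists_orthogonal (fr : IsFrame q d G P a b Y) (hF : IsHermitianField q F) :
    ∃ w, herm q P w = 0 ∧ herm q a w = 0 ∧ herm q b w = 0 ∧ herm q w w ≠ 0 ∧
      ∀ v, herm q P v = 0 → herm q a v = 0 → herm q b v = 0 → ∃ x z : F, v = x • w + z • P := by
  have hk := finrank_ker_hermMap hF (fr.linearIndependent hF)
  set N := LinearMap.ker (hermMap q ![P, a, b]) with hN
  have hmem : ∀ v, v ∈ N ↔ herm q P v = 0 ∧ herm q a v = 0 ∧ herm q b v = 0 := fun v => by
    rw [hN, LinearMap.mem_ker, funext_iff, Fin.forall_fin_succ, Fin.forall_fin_two]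
    rfl
  have hPN : F ∙ P ≤ N := by
    rw [Submodule.span_singleton_le_iff_mem, hmem]
    exact ⟨fr.herm_PP, herm_swap_eq_zero hF fr.herm_Pa, herm_swap_eq_zero hF fr.herm_Pb⟩
  have hlt : F ∙ P < N := lt_of_le_of_ne hPN fun h => by
    have := finrank_span_singleton (K := F) fr.ne_zero
    rw [h] at this
    omega
  obtain ⟨w, hwN, hwP⟩ := SetLike.exists_of_lt hlt
  obtain ⟨h1, h2, h3⟩ := (hmem w).1 hwN
  have hwP' : ∀ x z : F, x • P + z • w = 0 → x = 0 ∧ z = 0 := fun x z h => by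
    have hz : z = 0 := by
      by_contra hz
      refine hwP (Submodule.mem_span_singleton.2 ⟨-(z⁻¹ * x), ?_⟩)
      have h' := congrArg (z⁻¹ • ·) h
      simp only [smul_add, smul_smul, inv_mul_cancel₀ hz, one_smul, smul_zero] at h'
      rw [neg_smul]
      exact neg_eq_of_add_eq_zero_right h'
    rw [hz, zero_smul, add_zero] at h
    exact ⟨(smul_eq_zero.1 h).resolve_right fr.ne_zero, hz⟩
  refine ⟨w, h1, h2, h3, fun hww => ?_, fun v hv1 hv2 hv3 => ?_⟩
  · refine not_isotropic_triple hF (u := P) (v := a) (w := w)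
      (linearIndependent_triple_of_forall fun x y z h => ?_) fr.herm_PP fr.herm_aa hww fr.herm_Pa
      h1 h2
    have hy : y = 0 := by
      simpa [herm_add_right, herm_smul_right, herm_zero_right, fr.herm_ab, h3,
        herm_swap hF a b, herm_swap_eq_zero hF fr.herm_Pb] using congrArg (herm q b) h
    rw [hy, zero_smul, add_zero] at h
    exact ⟨(hwP' x z h).1, hy, (hwP' x z h).2⟩
  · have hli : LinearIndependent F ![w, P] := by
      rw [LinearIndependent.pair_iff]
      intro s t h
      rw [add_comm] at h
      exact (hwP' t s h).symm
    have hle : Submodule.span F (Set.range ![w, P]) ≤ N := by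
      rw [Submodule.span_le, Matrix.range_cons, Matrix.range_cons, Matrix.range_empty,
        Set.union_empty]
      rintro x (rfl | rfl)
      · exact hwN
      · exact hPN (Submodule.mem_span_singleton_self _)
    have heq := Submodule.eq_of_le_of_finrank_eq hle (by
      rw [finrank_span_eq_card hli, Fintype.card_fin]
      omega)
    have hv : v ∈ Submodule.span F (Set.range ![w, P]) := heq ▸ (hmem v).2 ⟨hv1, hv2, hv3⟩
    rw [Matrix.range_cons, Matrix.range_cons, Matrix.range_empty, Set.union_empty,
      Set.singleton_union] at hv
    obtain ⟨x, z, h⟩ := Submodule.mem_span_pair.1 hv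
    exact ⟨x, z, h.symm⟩

variable [DecidableEq F]

theorem card_zeros_add_smul_le (fr : IsFrame q d G P a b Y) (hF : IsHermitianField q F)
    (hG : G.IsHomogeneous d) (hd : d + 1 < q ^ 2) (u : Fin 5 → F) :
    (Finset.univ.filter fun y : F => eval (u + y • b) G = 0).card ≤ d := by
  rw [← hF.card_eq] at hd
  have htop := coeff_lineRestr_top hG hd u b
  have hb : eval b G ≠ 0 := by simpa using fr.eval_ne_zero 0
  have hne : lineRestr G u b ≠ 0 := fun h => hb (by rw [← htop, h, Polynomial.coeff_zero])
  refine le_trans (Polynomial.card_le_degree_of_subset_roots (p := lineRestr G u b)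
    fun y hy => ?_) (natDegree_lineRestr_le hG.totalDegree_le u b)
  rw [Polynomial.mem_roots hne, Polynomial.IsRoot, eval_lineRestr]
  exact (Finset.mem_filter.1 hy).2

theorem card_conic_zeros_le (fr : IsFrame q d G P a b Y) (hF : IsHermitianField q F)
    (hG : G.IsHomogeneous d) (hdq : d ≤ q) (hd : d + 1 < q ^ 2) {w : Fin 5 → F}
    (hw : herm q w w ≠ 0) (z : F) :
    (Finset.univ.filter fun p : Fin 2 → F => p 0 ≠ 0 ∧
      p 1 ^ q + p 1 + p 0 ^ (q + 1) * herm q w w = 0 ∧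
        eval (a + z • P + p 0 • w + p 1 • b) G = 0).card ≤ d * q := by
  set S := Finset.univ.filter fun p : Fin 2 → F => p 0 ≠ 0 ∧
      p 1 ^ q + p 1 + p 0 ^ (q + 1) * herm q w w = 0 ∧
        eval (a + z • P + p 0 • w + p 1 • b) G = 0 with hS
  have hc : coeff (Finsupp.single 1 d) (planeRestr G (a + z • P) w b) ≠ 0 := by
    rw [← hF.card_eq] at hd
    rw [← coeff_aeval_zero_X, aeval_planeRestr, coeff_lineRestr_top hG hd]
    simpa using fr.eval_ne_zero 0
  have hdisj : Disjoint S (Y.image fun y => ![0, y]) := by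
    rw [Finset.disjoint_left]
    intro p hp hp'
    obtain ⟨y, _, rfl⟩ := Finset.mem_image.1 hp'
    exact (Finset.mem_filter.1 hp).2.1 rfl
  have hcard := card_le_of_mem_curve hF.one_lt hdq
    (totalDegree_planeRestr_le hG.totalDegree_le (a + z • P) w b) hc (-(herm q w w)⁻¹)
    (S ∪ Y.image fun y => ![0, y]) fun p hp => ?_
  · rw [Finset.card_union_of_disjoint hdisj, Finset.card_image_of_injective, fr.card_eq] at hcard
    · linarith
    · intro y y' h
      exact congrFun h 1
  · rw [eval_planeRestr]
    rcases Finset.mem_union.1 hp with hp | hp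
    · obtain ⟨_, h1, h2⟩ := (Finset.mem_filter.1 hp).2
      refine ⟨h2, ?_⟩
      field_simp
      linear_combination h1
    · obtain ⟨y, hy, rfl⟩ := Finset.mem_image.1 hp
      have h := fr.eval_eq_zero y hy z 1
      simp only [Matrix.cons_val_zero, Matrix.cons_val_one]
      refine ⟨?_, ?_⟩
      · rwa [show a + z • P + (0 : F) • w + y • b = z • P + (1 : F) • (a + y • b) by module]
      · rw [fr.trace_eq_zero y hy, mul_zero, zero_pow (by omega)]

end IsFrame

end TangentCone

section Covering

variable {q d : ℕ} {F : Type} [Field F] {G : MvPolynomial (Fin 5) F}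

theorem herm_self (v : Fin 5 → F) : herm q v v = ∑ i, v i ^ (q + 1) := by
  simp only [herm, pow_succ]

theorem ncard_le_of_forall_exists_smul_mem (T : Finset (Fin 5 → F))
    (hT : ∀ v : Fin 5 → F, v ≠ 0 → herm q v v = 0 → eval v G = 0 → ∃ c : F, c ≠ 0 ∧ c • v ∈ T) :
    (VG G ∩ hermV3 q F).ncard ≤ T.card := by
  have h : ∀ x : P4 F, ∃ c : F, x ∈ VG G ∩ hermV3 q F → c ≠ 0 ∧ c • x.rep ∈ T := fun x => by
    by_cases hx : x ∈ VG G ∩ hermV3 q F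
    · obtain ⟨c, hc⟩ := hT x.rep x.rep_nonzero ((herm_self _).trans hx.2) hx.1
      exact ⟨c, fun _ => hc⟩
    · exact ⟨0, fun hx' => absurd hx' hx⟩
  choose c hc using h
  rw [← Set.ncard_coe_finset T]
  refine Set.ncard_le_ncard_of_injOn (fun x => c x • x.rep) (fun x hx => (hc x hx).2)
    (fun x hx y hy hxy => ?_) T.finite_toSet
  simp only at hxy
  rw [← x.mk_rep, ← y.mk_rep, Projectivization.mk_eq_mk_iff' F _ _ x.rep_nonzero y.rep_nonzero]
  refine ⟨(c x)⁻¹ * c y, ?_⟩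
  rw [mul_smul, ← hxy, smul_smul, inv_mul_cancel₀ (hc x hx).1, one_smul]

variable [Fintype F]

namespace IsFrame

variable {P a b : Fin 5 → F} {Y : Finset F}

theorem ncard_add_le (fr : IsFrame q d G P a b Y) (hF : IsHermitianField q F)
    (hG : G.IsHomogeneous d) (hd1 : 1 < d) (hdq : d ≤ q)
    (hpl : ∀ u v w : Fin 5 → F, LinearIndependent F ![u, v, w] →
      ∃ α β γ : F, eval (α • u + β • v + γ • w) G ≠ 0) :
    (VG G ∩ hermV3 q F).ncard + q ^ 4 ≤ d * q ^ 5 + d * q ^ 3 + d * q ^ 2 + 1 := by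
  classical
  have hd : d + 1 < q ^ 2 := by nlinarith
  obtain ⟨w, hPw, haw, hbw, hww, hspan⟩ := fr.exists_orthogonal hF
  have hba : herm q b a = 1 := by rw [herm_swap hF a b, fr.herm_ab, one_pow]
  set T₁ := (affineCone q P).filter fun v => eval v G = 0 with hT₁
  set T₂ := (Finset.univ : Finset F).biUnion fun z =>
    (Finset.univ.filter fun p : Fin 2 → F => p 0 ≠ 0 ∧
      p 1 ^ q + p 1 + p 0 ^ (q + 1) * herm q w w = 0 ∧
        eval (a + z • P + p 0 • w + p 1 • b) G = 0).image
      fun p => a + z • P + p 0 • w + p 1 • b with hT₂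
  set T₃ := (Finset.univ : Finset F).biUnion fun z =>
    (Finset.univ.filter fun y : F => eval (a + z • P + y • b) G = 0).image
      fun y => a + z • P + y • b with hT₃
  have h₁ : T₁.card + q ^ 4 ≤ d * q ^ 5 := fr.card_affineCone_zeros_add_le hF hG hd1 hdq hpl
  have h₂ : T₂.card ≤ q ^ 2 * (d * q) := by
    rw [← hF.card_eq, ← Finset.card_univ]
    exact Finset.card_biUnion_le_card_mul _ _ _ fun z _ =>
      Finset.card_image_le.trans (fr.card_conic_zeros_le hF hG hdq hd hww z)
  have h₃ : T₃.card ≤ q ^ 2 * d := by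
    rw [← hF.card_eq, ← Finset.card_univ]
    exact Finset.card_biUnion_le_card_mul _ _ _ fun z _ =>
      Finset.card_image_le.trans (fr.card_zeros_add_smul_le hF hG hd _)
  have hcard : (T₁ ∪ T₂ ∪ T₃ ∪ {P}).card ≤ T₁.card + T₂.card + T₃.card + 1 := by
    refine (Finset.card_union_le _ _).trans (Nat.add_le_add ?_ (Finset.card_singleton P).le)
    exact (Finset.card_union_le _ _).trans (Nat.add_le_add_right (Finset.card_union_le _ _) _)
  have hcov := ncard_le_of_forall_exists_smul_mem (q := q) (G := G) (T₁ ∪ T₂ ∪ T₃ ∪ {P})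
    fun v hv0 hvv hGv => ?_
  · nlinarith
  have hscale : ∀ c : F, herm q (c • v) (c • v) = 0 ∧ eval (c • v) G = 0 := fun c => by
    rw [herm_smul_right, herm_smul_left, hvv, eval_smul_of_isHomogeneous hG, hGv]
    simp
  simp only [Finset.mem_union, Finset.mem_singleton]
  by_cases hPv : herm q P v = 0
  swap
  · refine ⟨(herm q P v)⁻¹, inv_ne_zero hPv, Or.inl (Or.inl (Or.inl ?_))⟩
    rw [hT₁, Finset.mem_filter, mem_affineCone, herm_smul_right, inv_mul_cancel₀ hPv]
    exact ⟨⟨rfl, (hscale _).1⟩, (hscale _).2⟩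
  by_cases hbv : herm q b v = 0
  · obtain ⟨x, z, hxz⟩ := hspan (v - herm q a v • b)
      (by simp [herm_sub_right, herm_smul_right, hPv, fr.herm_Pb])
      (by simp [herm_sub_right, herm_smul_right, fr.herm_ab])
      (by simp [herm_sub_right, herm_smul_right, hbv, fr.herm_bb])
    rw [sub_eq_iff_eq_add] at hxz
    generalize herm q a v = y at hxz
    subst hxz
    have hx : x = 0 := by
      simp only [herm_add_right, herm_add_left hF, herm_smul_right, herm_smul_left,
        fr.herm_bb, fr.herm_PP, fr.herm_Pb, hPw, hbw, herm_swap_eq_zero hF fr.herm_Pb,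
        herm_swap_eq_zero hF hPw, herm_swap_eq_zero hF hbw] at hvv
      have : x ^ (q + 1) * herm q w w = 0 := by linear_combination hvv
      exact pow_eq_zero_iff (by omega) |>.1 ((mul_eq_zero.1 this).resolve_right hww)
    subst hx
    rw [zero_smul, zero_add] at hv0 hGv hscale ⊢
    have hy : y = 0 := by
      by_contra hy
      refine fr.eval_ne_zero (y⁻¹ * z) ?_
      rw [← (hscale y⁻¹).2, smul_add, smul_smul, smul_smul, inv_mul_cancel₀ hy, one_smul, add_comm]
    subst hy
    rw [zero_smul, add_zero] at hv0 ⊢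
    have hz : z ≠ 0 := fun h => hv0 (by rw [h, zero_smul])
    exact ⟨z⁻¹, inv_ne_zero hz, Or.inr (by rw [smul_smul, inv_mul_cancel₀ hz, one_smul])⟩
  · refine ⟨(herm q b v)⁻¹, inv_ne_zero hbv, Or.inl ?_⟩
    obtain ⟨hvv, hGv⟩ := hscale (herm q b v)⁻¹
    have hbv' : herm q b ((herm q b v)⁻¹ • v) = 1 := by
      rw [herm_smul_right, inv_mul_cancel₀ hbv]
    have hPv' : herm q P ((herm q b v)⁻¹ • v) = 0 := by rw [herm_smul_right, hPv, mul_zero]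
    generalize (herm q b v)⁻¹ • v = u at *
    obtain ⟨x, z, hxz⟩ := hspan (u - (a + herm q a u • b))
      (by simp [herm_sub_right, herm_smul_right, herm_add_right, hPv', fr.herm_Pa, fr.herm_Pb])
      (by simp [herm_sub_right, herm_smul_right, herm_add_right, fr.herm_ab, fr.herm_aa])
      (by simp [herm_sub_right, herm_smul_right, herm_add_right, hbv', fr.herm_bb, hba])
    rw [sub_eq_iff_eq_add] at hxz
    generalize herm q a u = y at hxz
    have hu : u = a + z • P + x • w + y • b := by rw [hxz]; abel
    by_cases hx : x = 0
    · rw [hx, zero_smul, add_zero] at hu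
      refine Or.inr (Finset.mem_biUnion.2 ⟨z, Finset.mem_univ _, Finset.mem_image.2 ⟨y, ?_, hu.symm⟩⟩)
      rw [hu] at hGv
      exact Finset.mem_filter.2 ⟨Finset.mem_univ _, hGv⟩
    · refine Or.inl (Or.inr (Finset.mem_biUnion.2 ⟨z, Finset.mem_univ _, Finset.mem_image.2
        ⟨![x, y], ?_, hu.symm⟩⟩))
      refine Finset.mem_filter.2 ⟨Finset.mem_univ _, hx, ?_, hu ▸ hGv⟩
      subst hu
      simp only [herm_add_right, herm_add_left hF, herm_smul_right, herm_smul_left,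
        fr.herm_aa, fr.herm_bb, fr.herm_PP, fr.herm_Pb, fr.herm_Pa, fr.herm_ab, hba, hPw, hbw, haw,
        herm_swap_eq_zero hF fr.herm_Pb, herm_swap_eq_zero hF fr.herm_Pa,
        herm_swap_eq_zero hF hPw, herm_swap_eq_zero hF hbw, herm_swap_eq_zero hF haw] at hvv
      simp only [Matrix.cons_val_zero, Matrix.cons_val_one]
      linear_combination hvv

end IsFrame

end Covering

section Generators

variable {q d : ℕ} {F : Type} [Field F]

theorem exists_eq_smul_add_smul {W : Submodule F (Fin 5 → F)} (hW : Module.finrank F W = 2)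
    {P a : Fin 5 → F} (hP : P ≠ 0) (hPW : P ∈ W) (haW : a ∈ W) (haP : a ∉ F ∙ P) {v : Fin 5 → F}
    (hv : v ∈ W) : ∃ x y : F, x • P + y • a = v := by
  have hli : LinearIndependent F ![P, a] := (LinearIndependent.pair_iff' hP).2
    fun c hc => haP (Submodule.mem_span_singleton.2 ⟨c, hc⟩)
  have hle : Submodule.span F {P, a} ≤ W := by
    rw [Submodule.span_le]
    rintro x (rfl | rfl) <;> assumption
  have hr : Set.range ![P, a] = {P, a} := by
    rw [Matrix.range_cons, Matrix.range_cons, Matrix.range_empty, Set.union_empty,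
      Set.singleton_union]
  have heq := Submodule.eq_of_le_of_finrank_eq hle (by
    rw [← hr, finrank_span_eq_card hli, Fintype.card_fin, hW])
  rw [← heq] at hv
  exact Submodule.mem_span_pair.1 hv

theorem exists_mem_notMem_span_singleton {W : Submodule F (Fin 5 → F)}
    (hW : Module.finrank F W = 2) (P : Fin 5 → F) : ∃ a ∈ W, a ∉ F ∙ P := by
  by_contra! h
  have h1 := Submodule.finrank_mono (show W ≤ F ∙ P from h)
  have h2 := finrank_span_le_card (R := F) ({P} : Set (Fin 5 → F))
  simp only [Set.toFinset_singleton, Finset.card_singleton] at h2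
  omega

theorem exists_add_smul_mem {W : Submodule F (Fin 5 → F)} (hW : Module.finrank F W = 2)
    {P a b : Fin 5 → F} (hPW : P ∈ W) (hb : b ∉ W)
    (hspan : ∀ v ∈ W, ∃ x s t : F, x • P + s • a + t • b = v) : ∃ y : F, a + y • b ∈ W := by
  obtain ⟨u, hu, huP⟩ := exists_mem_notMem_span_singleton hW P
  obtain ⟨x, s, t, rfl⟩ := hspan u hu
  have h1 : s • a + t • b ∈ W := by
    have := W.sub_mem hu (W.smul_mem x hPW)
    rwa [add_assoc, add_sub_cancel_left] at this
  by_cases hs : s = 0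
  · rw [hs, zero_smul, zero_add] at h1
    by_cases ht : t = 0
    · refine absurd (Submodule.mem_span_singleton.2 ⟨x, ?_⟩) huP
      rw [hs, ht, zero_smul, zero_smul, add_zero, add_zero]
    · exact absurd ((W.smul_mem_iff ht).1 h1) hb
  · refine ⟨s⁻¹ * t, ?_⟩
    have := W.smul_mem s⁻¹ h1
    rwa [smul_add, smul_smul, smul_smul, inv_mul_cancel₀ hs, one_smul] at this

variable [Fintype F]

theorem herm_eq_zero_of_forall_isotropic (hF : IsHermitianField q F)
    {W : Submodule F (Fin 5 → F)} (h : ∀ v ∈ W, herm q v v = 0) {u v : Fin 5 → F} (hu : u ∈ W)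
    (hv : v ∈ W) : herm q u v = 0 := by
  classical
  by_contra hne
  have h1 : ∀ x : F, x ^ q + x = 0 := fun x => by
    have h2 := h (u + (x / herm q u v) • v) (W.add_mem hu (W.smul_mem _ hv))
    simp only [herm_add_right, herm_add_left hF, herm_smul_right, herm_smul_left, h u hu, h v hv,
      herm_swap hF u v] at h2
    have h3 := div_mul_cancel₀ x hne
    have h4 : (x / herm q u v) ^ q * herm q u v ^ q = x ^ q := by rw [← mul_pow, h3]
    linear_combination h2 - h3 - h4
  have h2 := hF.card_trace_zero
  rw [Finset.filter_true_of_mem fun x _ => h1 x, Finset.card_univ, hF.card_eq] at h2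
  have := hF.one_lt
  nlinarith

theorem mem_of_isotropic (hF : IsHermitianField q F) {W : Submodule F (Fin 5 → F)}
    (hW : Module.finrank F W = 2) (h : ∀ v ∈ W, herm q v v = 0) {P : Fin 5 → F}
    (hPP : herm q P P = 0) (hPW : ∀ v ∈ W, herm q P v = 0) : P ∈ W := by
  by_contra hP
  obtain ⟨u, hu, hu0⟩ := exists_mem_notMem_span_singleton hW 0
  obtain ⟨w, hw, hwu⟩ := exists_mem_notMem_span_singleton hW u
  replace hu0 : u ≠ 0 := fun h0 => hu0 (by rw [h0]; exact Submodule.zero_mem _)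
  refine not_isotropic_triple hF (linearIndependent_triple_of_forall fun x y z h0 => ?_) hPP
    (h u hu) (h w hw) (hPW u hu) (hPW w hw) (herm_eq_zero_of_forall_isotropic hF h hu hw)
  have hx : x = 0 := by
    by_contra hx
    refine hP ((W.smul_mem_iff hx).1 ?_)
    rw [add_assoc] at h0
    rw [eq_neg_of_add_eq_zero_left h0]
    exact W.neg_mem (W.add_mem (W.smul_mem _ hu) (W.smul_mem _ hw))
  rw [hx, zero_smul, zero_add] at h0
  have hz : z = 0 := by
    by_contra hz
    refine hwu (((F ∙ u).smul_mem_iff hz).1 ?_)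
    rw [eq_neg_of_add_eq_zero_right h0]
    exact Submodule.neg_mem _ (Submodule.smul_mem _ _ (Submodule.mem_span_singleton_self u))
  rw [hz, zero_smul, add_zero] at h0
  exact ⟨hx, (smul_eq_zero.1 h0).resolve_right hu0, hz⟩

theorem eval_add_smul_ne_zero {G : MvPolynomial (Fin 5) F} (hG : G.IsHomogeneous d)
    (hd : d + 1 < Fintype.card F) {P a b : Fin 5 → F}
    (hpl : ∃ α β γ : F, eval (α • P + β • a + γ • b) G ≠ 0) {Y : Finset F} (hY : Y.card = d)
    (hzero : ∀ y ∈ Y, ∀ s : F, eval (s • P + (a + y • b)) G = 0) (z : F) :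
    eval (b + z • P) G ≠ 0 := by
  classical
  intro hQ
  have hdeg := hG.totalDegree_le
  have h1 : ∀ x t : F, eval (x • P + a + t • (b + z • P)) G = 0 := fun x t => by
    have htop := coeff_lineRestr_top hG hd (x • P + a) (b + z • P)
    rw [hQ] at htop
    have hle := natDegree_lineRestr_le hdeg (x • P + a) (b + z • P)
    rw [← eval_lineRestr]
    suffices h : lineRestr G (x • P + a) (b + z • P) = 0 by rw [h, Polynomial.eval_zero]
    by_contra hne
    refine hne (Polynomial.eq_zero_of_natDegree_lt_card_of_eval_eq_zero' _ Y (fun y hy => ?_) ?_)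
    · rw [eval_lineRestr, ← hzero y hy (x + y * z)]
      congr 2
      module
    · rw [hY]
      refine lt_of_le_of_ne hle fun h' => hne ?_
      rw [← Polynomial.leadingCoeff_eq_zero, Polynomial.leadingCoeff, h', htop]
  have h2 : ∀ α β γ : F, β ≠ 0 → eval (α • P + β • a + γ • b) G = 0 := fun α β γ hβ => by
    have h := h1 (β⁻¹ * α - β⁻¹ * γ * z) (β⁻¹ * γ)
    have h3 : α • P + β • a + γ • b =
        β • ((β⁻¹ * α - β⁻¹ * γ * z) • P + a + (β⁻¹ * γ) • (b + z • P)) := by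
      match_scalars <;> field_simp
      ring
    rw [h3, eval_smul_of_isHomogeneous hG, h, mul_zero]
  obtain ⟨α, β, γ, hne⟩ := hpl
  by_cases hβ : β = 0
  · refine hne ?_
    have h : lineRestr G (α • P + γ • b) a = 0 := by
      refine Polynomial.eq_zero_of_natDegree_lt_card_of_eval_eq_zero' _ (Finset.univ.erase 0)
        (fun t ht => ?_) ?_
      · rw [eval_lineRestr, ← h2 α t γ (Finset.ne_of_mem_erase ht)]
        congr 2
        module
      · rw [Finset.card_erase_of_mem (Finset.mem_univ _), Finset.card_univ]
        have := natDegree_lineRestr_le hdeg (α • P + γ • b) a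
        omega
    rw [hβ, zero_smul, add_zero, ← add_zero (α • P + γ • b), ← zero_smul F a, ← eval_lineRestr, h,
      Polynomial.eval_zero]
  · exact hne (h2 α β γ hβ)

end Generators

section ExistsFrame

variable {q d : ℕ} {F : Type} [Field F] [Fintype F]

theorem exists_isFrame (hF : IsHermitianField q F) {G : MvPolynomial (Fin 5) F}
    (hG : G.IsHomogeneous d) (hd1 : 1 < d) (hdq : d ≤ q)
    (hpl : ∀ u v w : Fin 5 → F, LinearIndependent F ![u, v, w] →
      ∃ α β γ : F, eval (α • u + β • v + γ • w) G ≠ 0)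
    {W₀ : Submodule F (Fin 5 → F)} (hW₀ : Module.finrank F W₀ = 3)
    {W : Fin d → Submodule F (Fin 5 → F)} (hinj : Function.Injective W)
    (hW : ∀ i, Module.finrank F (W i) = 2) (hle : ∀ i, W i ≤ W₀)
    (hiso : ∀ i, ∀ v ∈ W i, herm q v v = 0) (hzero : ∀ i, ∀ v ∈ W i, eval v G = 0) :
    ∃ (P a b : Fin 5 → F) (Y : Finset F), IsFrame q d G P a b Y := by
  classical
  set i₀ : Fin d := ⟨0, by omega⟩ with hi₀
  set i₁ : Fin d := ⟨1, hd1⟩ with hi₁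
  have hne : W i₀ ≠ W i₁ := fun h => by simpa [hi₀, hi₁] using hinj h
  have hdim := Submodule.finrank_sup_add_finrank_inf_eq (W i₀) (W i₁)
  have hsup : W i₀ ⊔ W i₁ ≤ W₀ := sup_le (hle i₀) (hle i₁)
  have hsup3 := Submodule.finrank_mono hsup
  have hlt : W i₀ ⊓ W i₁ < W i₀ := lt_of_le_of_ne inf_le_left fun h =>
    hne (Submodule.eq_of_le_of_finrank_eq (inf_eq_left.1 h) (by rw [hW, hW]))
  have hinf1 := Submodule.finrank_lt_finrank_of_lt hlt
  have hinf : Module.finrank F (W i₀ ⊓ W i₁ : Submodule F (Fin 5 → F)) = 1 := by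
    rw [hW] at hinf1
    rw [hW, hW] at hdim
    omega
  have hsupeq : W i₀ ⊔ W i₁ = W₀ := Submodule.eq_of_le_of_finrank_eq hsup (by
    rw [hW, hW] at hdim
    omega)
  obtain ⟨⟨P, hP₀, hP₁⟩, hP, hPspan⟩ := finrank_eq_one_iff'.1 hinf
  have hP : P ≠ 0 := fun h => hP (Subtype.ext h)
  have hmem : ∀ v ∈ W i₀, v ∈ W i₁ → v ∈ F ∙ P := fun v h0 h1 => by
    obtain ⟨c, hc⟩ := hPspan ⟨v, h0, h1⟩
    exact Submodule.mem_span_singleton.2 ⟨c, congrArg Subtype.val hc⟩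
  have hPP : herm q P P = 0 := hiso i₀ P hP₀
  have hPW₀ : ∀ v ∈ W₀, herm q P v = 0 := fun v hv => by
    rw [← hsupeq] at hv
    obtain ⟨x, hx, y, hy, rfl⟩ := Submodule.mem_sup.1 hv
    rw [herm_add_right, herm_eq_zero_of_forall_isotropic hF (hiso i₀) hP₀ hx,
      herm_eq_zero_of_forall_isotropic hF (hiso i₁) hP₁ hy, add_zero]
  have hPW : ∀ i, P ∈ W i := fun i =>
    mem_of_isotropic hF (hW i) (hiso i) hPP fun v hv => hPW₀ v (hle i hv)
  obtain ⟨a, ha, haP⟩ := exists_mem_notMem_span_singleton (hW i₀) P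
  obtain ⟨b₀, hb₀, hb₀P⟩ := exists_mem_notMem_span_singleton (hW i₁) P
  have hb₀W : b₀ ∉ W i₀ := fun h => hb₀P (hmem _ h hb₀)
  have hli₀ : LinearIndependent F ![P, a, b₀] :=
    linearIndependent_triple_of_forall fun x y z h => by
      have hz : z = 0 := by
        by_contra hz
        refine hb₀W (((W i₀).smul_mem_iff hz).1 ?_)
        rw [eq_neg_of_add_eq_zero_right h]
        exact neg_mem (add_mem (Submodule.smul_mem _ _ hP₀) (Submodule.smul_mem _ _ ha))
      rw [hz, zero_smul, add_zero] at h
      have hy : y = 0 := by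
        by_contra hy
        refine haP (((F ∙ P).smul_mem_iff hy).1 ?_)
        rw [eq_neg_of_add_eq_zero_right h]
        exact neg_mem (Submodule.smul_mem _ _ (Submodule.mem_span_singleton_self P))
      rw [hy, zero_smul, add_zero] at h
      exact ⟨(smul_eq_zero.1 h).resolve_right hP, hy, hz⟩
  have haa := hiso i₀ a ha
  have hab₀ : herm q a b₀ ≠ 0 := fun h => not_isotropic_triple hF hli₀ hPP haa
    (hiso i₁ b₀ hb₀) (hPW₀ a (hle i₀ ha)) (hPW₀ b₀ (hle i₁ hb₀)) h
  set b₁ := (herm q a b₀)⁻¹ • b₀ with hb₁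
  have hb₁W : b₁ ∈ W i₁ := Submodule.smul_mem _ _ hb₀
  have hb₁₀ : b₁ ∉ W i₀ := fun h => hb₀W (((W i₀).smul_mem_iff (inv_ne_zero hab₀)).1 h)
  have hb₁P : b₁ ∉ F ∙ P := fun h => hb₁₀ ((Submodule.span_singleton_le_iff_mem _ _).2 hP₀ h)
  have hab₁ : herm q a b₁ = 1 := by rw [hb₁, herm_smul_right, inv_mul_cancel₀ hab₀]
  have hba₁ : herm q b₁ a = 1 := by rw [herm_swap hF a b₁, hab₁, one_pow]
  have hbb₁ : herm q b₁ b₁ = 0 := hiso i₁ b₁ hb₁W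
  have hspan₁ : ∀ v ∈ W₀, ∃ x s t : F, x • P + s • a + t • b₁ = v := fun v hv => by
    rw [← hsupeq] at hv
    obtain ⟨u, hu, w, hw, rfl⟩ := Submodule.mem_sup.1 hv
    obtain ⟨x, s, rfl⟩ := exists_eq_smul_add_smul (hW i₀) hP hP₀ ha haP hu
    obtain ⟨x', t, rfl⟩ := exists_eq_smul_add_smul (hW i₁) hP hP₁ hb₁W hb₁P hw
    exact ⟨x + x', s, t, by module⟩
  have hline : ∀ i j u, u ∈ W i → u ∈ W j → u ∉ F ∙ P → i = j := fun i j u hi hj hu => by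
    refine hinj (Submodule.eq_of_le_of_finrank_eq (fun v hv => ?_) (by rw [hW, hW]))
    obtain ⟨x, y, rfl⟩ := exists_eq_smul_add_smul (hW i) hP (hPW i) hi hu hv
    exact add_mem (Submodule.smul_mem _ _ (hPW j)) (Submodule.smul_mem _ _ hj)
  have hb : ∃ b ∈ W₀, herm q a b = 1 ∧ herm q b b = 0 ∧ (∀ i, b ∉ W i) ∧
      ∀ v ∈ W₀, ∃ x s t : F, x • P + s • a + t • b = v := by
    have h1 : ∀ i, ∃ y : F, i ≠ i₁ → a + y • b₁ ∈ W i := fun i => by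
      by_cases hi : i = i₁
      · exact ⟨0, fun h => absurd hi h⟩
      · obtain ⟨y, hy⟩ := exists_add_smul_mem (hW i) (hPW i)
          (fun h => hi (hline i i₁ b₁ h hb₁W hb₁P)) fun v hv => hspan₁ v (hle i hv)
        exact ⟨y, fun _ => hy⟩
    choose y hy using h1
    set K := Finset.univ.filter fun μ : F => μ ^ q + μ = 0 with hK
    have hcard : ((Finset.univ.erase i₁).image y).card < K.card := by
      refine Finset.card_image_le.trans_lt ?_
      rw [hF.card_trace_zero, Finset.card_erase_of_mem (Finset.mem_univ _), Finset.card_univ,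
        Fintype.card_fin]
      omega
    obtain ⟨c, hcK, hc⟩ := Finset.exists_mem_notMem_of_card_lt_card hcard
    have hcy : ∀ i, a + c • b₁ ∉ W i := fun i hi => by
      by_cases h1 : i = i₁
      · rw [h1] at hi
        have h2 := sub_mem hi ((W i₁).smul_mem c hb₁W)
        rw [add_sub_cancel_right] at h2
        exact haP (hmem a ha h2)
      · have h2 := sub_mem hi (hy i h1)
        rw [add_sub_add_left_eq_sub, ← sub_smul] at h2
        by_cases h3 : c - y i = 0
        · rw [sub_eq_zero.1 h3] at hc
          exact hc (Finset.mem_image_of_mem y (Finset.mem_erase.2 ⟨h1, Finset.mem_univ i⟩))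
        · exact h1 (hline i i₁ b₁ (((W i).smul_mem_iff h3).1 h2) hb₁W hb₁P)
    have hc0 : c ≠ 0 := fun h => hcy i₀ (by rwa [h, zero_smul, add_zero])
    have hcK' : c ^ q + c = 0 := (Finset.mem_filter.1 hcK).2
    have hbc : c⁻¹ • a + b₁ = c⁻¹ • (a + c • b₁) := by
      rw [smul_add, smul_smul, inv_mul_cancel₀ hc0, one_smul]
    refine ⟨c⁻¹ • a + b₁, add_mem (W₀.smul_mem _ (hle i₀ ha)) (hle i₁ hb₁W), ?_, ?_, ?_, ?_⟩
    · rw [herm_add_right, herm_smul_right, haa, hab₁, mul_zero, zero_add]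
    · simp only [herm_add_right, herm_add_left hF, herm_smul_right, herm_smul_left, haa, hab₁,
        hba₁, hbb₁]
      have h1 : c⁻¹ ^ q * c ^ q = 1 := by rw [← mul_pow, inv_mul_cancel₀ hc0, one_pow]
      have h2 := inv_mul_cancel₀ hc0
      linear_combination (c⁻¹ * c⁻¹ ^ q) * hcK' - c⁻¹ * h1 - c⁻¹ ^ q * h2
    · intro i h
      rw [hbc] at h
      exact hcy i (((W i).smul_mem_iff (inv_ne_zero hc0)).1 h)
    · intro v hv
      obtain ⟨x, s, t, rfl⟩ := hspan₁ v hv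
      exact ⟨x, s - t * c⁻¹, t, by module⟩
  obtain ⟨b, hbW₀, hab, hbb, hbW, hspan⟩ := hb
  have hba : herm q b a = 1 := by rw [herm_swap hF a b, hab, one_pow]
  have hPa := hPW₀ a (hle i₀ ha)
  have hPb := hPW₀ b hbW₀
  have haP' : herm q a P = 0 := herm_swap_eq_zero hF hPa
  have hbP : herm q b P = 0 := herm_swap_eq_zero hF hPb
  have hy : ∀ i, ∃ y : F, a + y • b ∈ W i := fun i =>
    exists_add_smul_mem (hW i) (hPW i) (hbW i) fun v hv => hspan v (hle i hv)
  choose y hy using hy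
  have hyinj : Function.Injective y := fun i j hij => by
    refine hline i j (a + y i • b) (hy i) (hij ▸ hy j) fun h => ?_
    obtain ⟨x, hx⟩ := Submodule.mem_span_singleton.1 h
    have h1 := congrArg (herm q b) hx
    rw [herm_smul_right, herm_add_right, herm_smul_right, hbP, hba, hbb] at h1
    simp at h1
  have hYcard : (Finset.univ.image y).card = d := by
    rw [Finset.card_image_of_injective _ hyinj, Finset.card_univ, Fintype.card_fin]
  have hYzero : ∀ z ∈ Finset.univ.image y, ∀ s t : F,
      eval (s • P + t • (a + z • b)) G = 0 := fun z hz s t => by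
    obtain ⟨i, -, rfl⟩ := Finset.mem_image.1 hz
    exact hzero i _ (add_mem ((W i).smul_mem _ (hPW i)) ((W i).smul_mem _ (hy i)))
  have hli : LinearIndependent F ![P, a, b] :=
    linearIndependent_triple_of_forall fun x y z h => by
      have hz := congrArg (herm q a) h
      have hy := congrArg (herm q b) h
      simp only [herm_add_right, herm_smul_right, herm_zero_right, haP', hbP, haa, hbb, hab, hba,
        mul_zero, mul_one, zero_add, add_zero] at hz hy
      rw [hz, hy, zero_smul, zero_smul, add_zero, add_zero] at h
      exact ⟨(smul_eq_zero.1 h).resolve_right hP, hy, hz⟩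
  refine ⟨P, a, b, Finset.univ.image y, hP, hPP, hPa, hPb, haa, hbb, hab, hYcard, ?_, hYzero,
    eval_add_smul_ne_zero hG ?_ (hpl P a b hli) hYcard fun z hz s => ?_⟩
  · intro z hz
    obtain ⟨i, -, rfl⟩ := Finset.mem_image.1 hz
    have h1 := hiso i _ (hy i)
    simp only [herm_add_right, herm_add_left hF, herm_smul_right, herm_smul_left, haa, hab, hba,
      hbb] at h1
    linear_combination h1
  · rw [hF.card_eq]
    nlinarith
  · have := hYzero z hz s 1
    rwa [one_smul] at this

end ExistsFrame

section Projective

variable {q d : ℕ} {F : Type} [Field F]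

theorem exists_smul_rep_eq {v : Fin 5 → F} (hv : v ≠ 0) :
    ∃ c : F, c • (Projectivization.mk F v hv).rep = v := by
  obtain ⟨c, hc⟩ := Projectivization.exists_smul_eq_mk_rep F v hv
  exact ⟨(c⁻¹ : Fˣ), by rw [← hc, ← Units.smul_def, inv_smul_smul]⟩

theorem eval_zero_of_isHomogeneous {G : MvPolynomial (Fin 5) F} (hG : G.IsHomogeneous d)
    (hd : d ≠ 0) : eval (0 : Fin 5 → F) G = 0 := by
  have h := eval_smul_of_isHomogeneous hG 0 0
  rwa [zero_smul, zero_pow hd, zero_mul] at h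

theorem eval_eq_zero_of_subset_VG {G : MvPolynomial (Fin 5) F} (hG : G.IsHomogeneous d)
    (hd : d ≠ 0) {W : Submodule F (Fin 5 → F)} (h : {x : P4 F | x.submodule ≤ W} ⊆ VG G)
    {v : Fin 5 → F} (hv : v ∈ W) : eval v G = 0 := by
  by_cases h0 : v = 0
  · rw [h0, eval_zero_of_isHomogeneous hG hd]
  · have h1 : Projectivization.mk F v h0 ∈ VG G := h (by
      rw [Set.mem_ofPred_eq, Projectivization.submodule_mk]
      exact (Submodule.span_singleton_le_iff_mem _ _).2 hv)
    obtain ⟨c, hc⟩ := exists_smul_rep_eq h0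
    rw [← hc, eval_smul_of_isHomogeneous hG, show eval _ G = 0 from h1, mul_zero]

theorem herm_self_eq_zero_of_subset_hermV3 {W : Submodule F (Fin 5 → F)}
    (h : {x : P4 F | x.submodule ≤ W} ⊆ hermV3 q F) {v : Fin 5 → F} (hv : v ∈ W) :
    herm q v v = 0 := by
  by_cases h0 : v = 0
  · rw [h0, herm_zero_right]
  · have h1 : Projectivization.mk F v h0 ∈ hermV3 q F := h (by
      rw [Set.mem_ofPred_eq, Projectivization.submodule_mk]
      exact (Submodule.span_singleton_le_iff_mem _ _).2 hv)
    obtain ⟨c, hc⟩ := exists_smul_rep_eq h0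
    rw [← hc, herm_smul_left, herm_smul_right, herm_self, show ∑ i, _ = (0 : F) from h1, mul_zero,
      mul_zero]

theorem le_of_forall_submodule_le {W W' : Submodule F (Fin 5 → F)}
    (h : {x : P4 F | x.submodule ≤ W} ⊆ {x : P4 F | x.submodule ≤ W'}) : W ≤ W' := by
  intro v hv
  by_cases h0 : v = 0
  · rw [h0]
    exact W'.zero_mem
  · have h1 := @h (Projectivization.mk F v h0) (by
      rw [Set.mem_ofPred_eq, Projectivization.submodule_mk]
      exact (Submodule.span_singleton_le_iff_mem _ _).2 hv)
    rw [Set.mem_ofPred_eq, Projectivization.submodule_mk] at h1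
    exact (Submodule.span_singleton_le_iff_mem _ _).1 h1

theorem exists_eval_ne_zero_of_linearIndependent {G : MvPolynomial (Fin 5) F}
    (h : ∀ S : Set (P4 F), IsPlane F S → ¬ S ⊆ VG G) {u v w : Fin 5 → F}
    (hli : LinearIndependent F ![u, v, w]) :
    ∃ α β γ : F, eval (α • u + β • v + γ • w) G ≠ 0 := by
  obtain ⟨x, hx, hxG⟩ := Set.not_subset.1 (h _ ⟨Submodule.span F (Set.range ![u, v, w]), by
    rw [finrank_span_eq_card hli, Fintype.card_fin], rfl⟩)
  have hx' : x.rep ∈ Submodule.span F (Set.range ![u, v, w]) := by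
    rw [Set.mem_ofPred_eq, Projectivization.submodule_eq] at hx
    exact (Submodule.span_singleton_le_iff_mem _ _).1 hx
  obtain ⟨c, hc⟩ := (Submodule.mem_span_range_iff_exists_fun F).1 hx'
  rw [Fin.sum_univ_three] at hc
  exact ⟨c 0, c 1, c 2, fun h0 => hxG ((congrArg (fun z => eval z G) hc).symm.trans h0)⟩

end Projective

theorem stmt7 (q : ℕ) (hq : IsPrimePow q)
    (F : Type) [Field F] [Fintype F] (hF : Fintype.card F = q ^ 2)
    (d : ℕ) (hd1 : 1 < d) (hdq : d ≤ q)
    (G : MvPolynomial (Fin 5) F) (hG : G ≠ 0) (hGd : G.IsHomogeneous d)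
    (hnoplane : ∀ S : Set (P4 F), IsPlane F S → ¬ S ⊆ VG G)
    (hgens : ∃ (Pl : Set (P4 F)) (g : Fin d → Set (P4 F)),
      IsPlane F Pl ∧ Function.Injective g ∧
      ∀ i, IsLine F (g i) ∧ g i ⊆ hermV3 q F ∧ g i ⊆ Pl ∩ VG G) :
    (VG G ∩ hermV3 q F).ncard ≤ d * q ^ 5 - q ^ 4 + d * q ^ 3 + d * q ^ 2 + 1 ∧
      d * q ^ 5 - q ^ 4 + d * q ^ 3 + d * q ^ 2 + 1 < d * (q ^ 5 + q ^ 2) + q ^ 3 + 1 := by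
  have hF' := isHermitianField_of_isPrimePow hq hF
  have hpl : ∀ u v w : Fin 5 → F, LinearIndependent F ![u, v, w] →
      ∃ α β γ : F, eval (α • u + β • v + γ • w) G ≠ 0 := fun _ _ _ =>
    exists_eval_ne_zero_of_linearIndependent hnoplane
  obtain ⟨_, g, ⟨W₀, hW₀, rfl⟩, hg, hgi⟩ := hgens
  choose hline hV hsub using hgi
  choose W hW hgW using hline
  obtain ⟨P, a, b, Y, fr⟩ := exists_isFrame hF' hGd hd1 hdq hpl hW₀
    (fun i j hij => hg (by rw [hgW i, hgW j, hij])) hW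
    (fun i => le_of_forall_submodule_le (hgW i ▸ (hsub i).trans Set.inter_subset_left))
    (fun i v hv => herm_self_eq_zero_of_subset_hermV3 (hgW i ▸ hV i) hv)
    (fun i v hv => eval_eq_zero_of_subset_VG hGd (by omega)
      (hgW i ▸ (hsub i).trans Set.inter_subset_right) hv)
  have hle := fr.ncard_add_le hF' hGd hd1 hdq hpl
  have hq0 : 0 < q := by omega
  have h4 : q ^ 4 ≤ d * q ^ 5 := calc
    q ^ 4 ≤ q ^ 5 := Nat.pow_le_pow_right hq0 (by norm_num)
    _ ≤ d * q ^ 5 := Nat.le_mul_of_pos_left _ (by omega)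
  have h3 : d * q ^ 3 ≤ q ^ 4 := calc
    d * q ^ 3 ≤ q * q ^ 3 := Nat.mul_le_mul_right _ hdq
    _ = q ^ 4 := by ring
  have hq3 : 0 < q ^ 3 := by positivity
  rw [mul_add]
  omega
end
end

section
/- Let q be a prime power and F a finite field with q^2 elements. If Σ_1 is a hyperplane of ℙ^4(F) that is not tangent to V_3, then for every hyperplane Σ of ℙ^4(F) one has |Σ ∩ Σ_1 ∩ V_3| ≥ q^3 + 1. -/
open MvPolynomial

noncomputable section

section Hermitian

variable {F : Type*} [Field F] {ι : Type*} [Fintype ι]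

/-- The standard form `∑ i, φ (x i) * y i`, semilinear in `x` along `φ` and linear in `y`. -/
def hermForm (φ : F →+* F) : (ι → F) →ₛₗ[φ] (ι → F) →ₗ[F] F :=
  LinearMap.mk₂'ₛₗ φ (RingHom.id F) (fun x y => ∑ i, φ (x i) * y i)
    (fun x y z => by simp [add_mul, Finset.sum_add_distrib])
    (fun c x y => by simp [Finset.mul_sum, mul_assoc])
    (fun x y z => by simp [mul_add, Finset.sum_add_distrib])
    (fun c x y => by simp [Finset.mul_sum, mul_left_comm])

lemma hermForm_apply (φ : F →+* F) (x y : ι → F) :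
    hermForm φ x y = ∑ i, φ (x i) * y i := rfl

lemma map_hermForm {φ : F →+* F} (hφ : Function.Involutive φ) (x y : ι → F) :
    φ (hermForm φ x y) = hermForm φ y x := by
  simp [hermForm_apply, hφ _, mul_comm]

lemma hermForm_injective (φ : F →+* F) :
    Function.Injective (hermForm φ : (ι → F) → (ι → F) →ₗ[F] F) := by
  classical
  intro x y hxy
  ext i
  have := LinearMap.congr_fun hxy (Pi.single i 1)
  exact φ.injective (by simpa [hermForm_apply, Pi.single_apply] using this)

lemma finrank_add_finrank_le_of_hermForm_eq_zero [Finite F] (φ : F →+* F)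
    (E T : Submodule F (ι → F)) (h : ∀ e ∈ E, ∀ t ∈ T, hermForm φ e t = 0) :
    Module.finrank F E + Module.finrank F T ≤ Fintype.card ι := by
  have hle : Nat.card E ≤ Nat.card T.dualAnnihilator := by
    have : Finite (Module.Dual F (ι → F)) := Module.finite_of_finite F
    refine Nat.card_le_card_of_injective
      (fun e => ⟨hermForm φ e.1, (Submodule.mem_dualAnnihilator _).2 (h e.1 e.2)⟩) ?_
    intro x y hxy
    exact Subtype.ext (hermForm_injective φ (congrArg Subtype.val hxy))
  rw [Module.natCard_eq_pow_finrank (K := F) (V := E),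
    Module.natCard_eq_pow_finrank (K := F) (V := T.dualAnnihilator),
    Nat.pow_le_pow_iff_right Finite.one_lt_card] at hle
  have := Subspace.finrank_add_finrank_dualAnnihilator_eq T
  rw [Module.finrank_fintype_fun_eq_card] at this
  omega

lemma hermForm_eq_zero_of_forall_self {φ : F →+* F} (hφ : Function.Involutive φ)
    (htr : ∃ d, d + φ d ≠ 0) (T : Submodule F (ι → F)) (h : ∀ x ∈ T, hermForm φ x x = 0)
    {x y : ι → F} (hx : x ∈ T) (hy : y ∈ T) : hermForm φ x y = 0 := by
  by_contra hne
  obtain ⟨d, hd⟩ := htr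
  apply hd
  have h1 := h _ (T.add_mem hx (T.smul_mem (d / hermForm φ x y) hy))
  have h2 : φ (hermForm φ x y) ≠ 0 := (map_ne_zero φ).2 hne
  simp only [map_add, LinearMap.add_apply, map_smul, LinearMap.map_smulₛₗ, LinearMap.smul_apply,
    h x hx, h y hy, ← map_hermForm hφ x y, smul_eq_mul, map_div₀, mul_zero, zero_add, add_zero,
    div_mul_cancel₀ _ h2, div_mul_cancel₀ _ hne] at h1
  rw [add_comm, h1]

lemma exists_hermForm_self_ne_zero [Finite F] {φ : F →+* F} (hφ : Function.Involutive φ)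
    (htr : ∃ d, d + φ d ≠ 0) (T E : Submodule F (ι → F)) (hTE : Disjoint T E)
    (h : ∀ e ∈ E, ∀ t ∈ T, hermForm φ e t = 0)
    (hcard : Fintype.card ι < 2 * Module.finrank F T + Module.finrank F E) :
    ∃ x ∈ T, hermForm φ x x ≠ 0 := by
  by_contra! hT
  have h1 := finrank_add_finrank_le_of_hermForm_eq_zero φ (T ⊔ E) T (by
    intro e he t ht
    obtain ⟨a, ha, b, hb, rfl⟩ := Submodule.mem_sup.1 he
    simp [hermForm_eq_zero_of_forall_self hφ htr T hT ha ht, h b hb t ht])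
  have h2 := Submodule.finrank_sup_add_finrank_inf_eq T E
  rw [hTE.eq_bot, finrank_bot] at h2
  omega

lemma finrank_le_finrank_inf_ker_add_one {V : Type*} [AddCommGroup V] [Module F V]
    [FiniteDimensional F V] (U : Submodule F V) (f : V →ₗ[F] F) :
    Module.finrank F U ≤ Module.finrank F (U ⊓ LinearMap.ker f : Submodule F V) + 1 := by
  have h1 := Submodule.finrank_sup_add_finrank_inf_eq U (LinearMap.ker f)
  have h2 := f.finrank_range_add_finrank_ker
  have h3 := Submodule.finrank_le (LinearMap.range f)
  have h4 := Submodule.finrank_le (U ⊔ LinearMap.ker f)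
  rw [Module.finrank_self] at h3
  omega

/-- Three pairwise orthogonal vectors, the first two non-isotropic, inside a subspace of
dimension at least `3` orthogonal to a non-isotropic vector of a `5`-dimensional space. -/
lemma exists_orthogonal_triple [Finite F] {φ : F →+* F} (hφ : Function.Involutive φ)
    (htr : ∃ d, d + φ d ≠ 0) (p : Fin 5 → F) (hp : hermForm φ p p ≠ 0)
    (U : Submodule F (Fin 5 → F)) (hU : 3 ≤ Module.finrank F U)
    (hpU : ∀ x ∈ U, hermForm φ p x = 0) :
    ∃ v ∈ U, ∃ w ∈ U, ∃ u ∈ U, hermForm φ v v ≠ 0 ∧ hermForm φ w w ≠ 0 ∧ u ≠ 0 ∧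
      hermForm φ v w = 0 ∧ hermForm φ v u = 0 ∧ hermForm φ w u = 0 := by
  obtain ⟨v, hv, hvv⟩ := exists_hermForm_self_ne_zero hφ htr U ⊥ disjoint_bot_right
    (by simp) (by simp; omega)
  have hd1 := finrank_le_finrank_inf_ker_add_one U (hermForm φ v)
  set U' := U ⊓ LinearMap.ker (hermForm φ v) with hU'
  have hpv : hermForm φ v p = 0 := by rw [← map_hermForm hφ, hpU v hv, map_zero]
  have hli : LinearIndependent F ![p, v] := by
    rw [LinearIndependent.pair_iff]
    intro a b hab
    have e1 := congrArg (hermForm φ p) hab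
    have e2 := congrArg (hermForm φ v) hab
    have hb : b = 0 := by simpa [hpv, hvv] using e2
    have ha : a = 0 := by simpa [hpU v hv, hp] using e1
    exact ⟨ha, hb⟩
  have hE : Module.finrank F (Submodule.span F {p, v}) = 2 := by
    have := finrank_span_eq_card hli
    rwa [Matrix.range_cons_cons_empty, Fintype.card_fin] at this
  obtain ⟨w, hw, hww⟩ := exists_hermForm_self_ne_zero hφ htr U' (Submodule.span F {p, v})
    (by
      rw [Submodule.disjoint_def]
      intro x hx hxE
      obtain ⟨a, b, rfl⟩ := Submodule.mem_span_pair.1 hxE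
      have e1 := hpU _ hx.1
      have e2 : hermForm φ v (a • p + b • v) = 0 := hx.2
      have hb : b = 0 := by simpa [hpv, hvv] using e2
      have ha : a = 0 := by simpa [hpU v hv, hp] using e1
      simp [ha, hb])
    (by
      intro e he t ht
      obtain ⟨a, b, rfl⟩ := Submodule.mem_span_pair.1 he
      have e2 : hermForm φ v t = 0 := ht.2
      simp [hpU t ht.1, e2])
    (by rw [hE, Fintype.card_fin]; omega)
  have hd2 := finrank_le_finrank_inf_ker_add_one U' (hermForm φ w)
  obtain ⟨u, hu, hu0⟩ := Submodule.exists_mem_ne_zero_of_ne_bot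
    (p := U' ⊓ LinearMap.ker (hermForm φ w)) (by
      intro h
      rw [h, finrank_bot] at hd2
      omega)
  exact ⟨v, hv, w, hw.1, u, hu.1.1, hvv, hww, hu0, hw.2, hu.1.2, hu.2⟩

end Hermitian

section NormCount

open Finset

variable {F : Type*} [Field F] [Fintype F] [DecidableEq F] {q : ℕ}

lemma card_filter_pow_succ_eq (hq : 1 < q) (hF : Fintype.card F = q ^ 2) {s : F}
    (hs : s ^ q = s) : #{x : F | x ^ (q + 1) = s} = if s = 0 then 1 else q + 1 := by
  split_ifs with h0
  · subst h0
    simp [filter_eq']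
  obtain ⟨g, hg⟩ := IsCyclic.exists_generator (α := Fˣ)
  obtain ⟨r, rfl⟩ : ∃ r, q = r + 1 := ⟨q - 1, by omega⟩
  have hord : orderOf g = r * (r + 1 + 1) := by
    rw [orderOf_eq_card_of_forall_mem_zpowers hg, Nat.card_eq_fintype_card, Fintype.card_units, hF,
      Nat.sub_eq_iff_eq_add (Nat.one_le_pow _ _ (by omega))]
    ring
  have hprim : IsPrimitiveRoot ((g : F) ^ r) (r + 1 + 1) := by
    have h1 : IsPrimitiveRoot (g : F) (r * (r + 1 + 1)) := by
      rw [← hord, ← orderOf_units]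
      exact IsPrimitiveRoot.orderOf _
    exact h1.pow (Nat.mul_pos (by omega) (by omega)) rfl
  have hex : ∃ x : F, x ^ (r + 1 + 1) = s := by
    obtain ⟨k, hk⟩ := (mem_powers_iff_mem_zpowers.2 (hg (Units.mk0 s h0)))
    have hk' : g ^ k = Units.mk0 s h0 := hk
    have hs1 : g ^ (k * r) = 1 := by
      rw [pow_mul, hk']
      ext
      rw [pow_succ] at hs
      simpa [h0] using hs
    have hdvd := orderOf_dvd_of_pow_eq_one hs1
    rw [hord, mul_comm] at hdvd
    obtain ⟨j, rfl⟩ := Nat.dvd_of_mul_dvd_mul_right (by omega) hdvd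
    refine ⟨(g : F) ^ j, ?_⟩
    rw [← pow_mul, mul_comm, ← Units.val_pow_eq_pow_val, hk', Units.val_mk0]
  have hnodup := hprim.nthRoots_nodup h0
  have hcard := hprim.card_nthRoots s
  rw [if_pos hex] at hcard
  refine Eq.trans ?_ ((Multiset.toFinset_card_of_nodup hnodup).trans hcard)
  congr 1
  ext x
  simp [Polynomial.mem_nthRoots]

lemma map_pow_succ_eq_self {F : Type*} [Field F] [Fintype F] {q : ℕ} {φ : F →+* F}
    (hφ : ∀ x, φ x = x ^ q) (hF : Fintype.card F = q ^ 2) (x : F) :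
    φ (x ^ (q + 1)) = x ^ (q + 1) := by
  rw [hφ, ← pow_mul, add_mul, one_mul, ← sq, pow_add, ← hF, FiniteField.pow_card, pow_succ,
    mul_comm]

lemma card_filter_add_pow_succ_eq {φ : F →+* F} (hφ : ∀ x, φ x = x ^ q) (hq : 1 < q)
    (hF : Fintype.card F = q ^ 2)
    {a b t : F} (ha0 : a ≠ 0) (hb0 : b ≠ 0) (ha : φ a = a) (hb : φ b = b) (ht : φ t = t) :
    #{x : F × F | a * x.1 ^ (q + 1) + b * x.2 ^ (q + 1) = t} + q * (if t = 0 then 1 else q + 1)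
      = q ^ 2 * (q + 1) := by
  have h1 : #{x : F × F | a * x.1 ^ (q + 1) + b * x.2 ^ (q + 1) = t} =
      ∑ y : F, #{x : F | x ^ (q + 1) = (t - b * y ^ (q + 1)) / a} := by
    simp only [card_filter]
    rw [Fintype.sum_prod_type_right]
    refine sum_congr rfl fun y _ => sum_congr rfl fun x _ => ?_
    congr 1
    rw [eq_div_iff ha0, eq_sub_iff_add_eq, mul_comm a]
  have h2 : ∀ y : F, #{x : F | x ^ (q + 1) = (t - b * y ^ (q + 1)) / a} +
      q * (if y ^ (q + 1) = t / b then 1 else 0) = q + 1 := by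
    intro y
    rw [card_filter_pow_succ_eq hq hF (by rw [← hφ]; simp [ha, hb, ht, map_pow_succ_eq_self hφ hF, -map_pow])]
    have : (t - b * y ^ (q + 1)) / a = 0 ↔ y ^ (q + 1) = t / b := by
      rw [div_eq_zero_iff, or_iff_left ha0, sub_eq_zero, eq_div_iff hb0, mul_comm b, eq_comm]
    simp only [this]
    split_ifs <;> ring
  have h3 : #{y : F | y ^ (q + 1) = t / b} = if t = 0 then 1 else q + 1 := by
    rw [card_filter_pow_succ_eq hq hF (by rw [← hφ]; simp [ht, hb])]
    simp [hb0]
  rw [h1, ← h3, card_filter, mul_sum, ← sum_add_distrib, sum_congr rfl fun y _ => h2 y]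
  simp [hF]

lemma le_card_filter_add_add_pow_succ_eq_zero {φ : F →+* F} (hφ : ∀ x, φ x = x ^ q) (hq : 1 < q)
    (hF : Fintype.card F = q ^ 2)
    {a b c : F} (ha0 : a ≠ 0) (hb0 : b ≠ 0) (ha : φ a = a) (hb : φ b = b) (hc : φ c = c) :
    q ^ 5 + q ^ 2 ≤ #{x : F × F × F | a * x.2.1 ^ (q + 1) + b * x.2.2 ^ (q + 1)
      + c * x.1 ^ (q + 1) = 0} + q ^ 3 := by
  have h1 : #{x : F × F × F | a * x.2.1 ^ (q + 1) + b * x.2.2 ^ (q + 1)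
      + c * x.1 ^ (q + 1) = 0} =
      ∑ z : F, #{x : F × F | a * x.1 ^ (q + 1) + b * x.2 ^ (q + 1) = -(c * z ^ (q + 1))} := by
    simp only [card_filter]
    rw [Fintype.sum_prod_type]
    simp only [eq_neg_iff_add_eq_zero]
  have h2 : ∀ z : F, q ^ 2 * (q + 1) + (if z = 0 then q ^ 2 else 0) ≤
      #{x : F × F | a * x.1 ^ (q + 1) + b * x.2 ^ (q + 1) = -(c * z ^ (q + 1))} +
        q * (q + 1) := by
    intro z
    have := card_filter_add_pow_succ_eq hφ hq hF ha0 hb0 ha hb (t := -(c * z ^ (q + 1)))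
      (by simp [hc, map_pow_succ_eq_self hφ hF, -map_pow])
    by_cases hz : z = 0
    · simp [hz] at this ⊢
      nlinarith
    · rw [if_neg hz]
      split_ifs at this <;> nlinarith
  have h3 := sum_le_sum fun z (_ : z ∈ univ) => h2 z
  rw [sum_add_distrib, sum_add_distrib, ← h1] at h3
  simp [hF] at h3
  nlinarith

end NormCount

lemma hermForm_smul_self_eq_zero_iff {F : Type*} [Field F] (φ : F →+* F) {ι : Type*} [Fintype ι]
    {c : F} (hc : c ≠ 0) (x : ι → F) :
    hermForm φ (c • x) (c • x) = 0 ↔ hermForm φ x x = 0 := by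
  simp [hc]

lemma exists_ringHom_eq_pow {q : ℕ} (hq : IsPrimePow q) {F : Type*} [Field F] [Fintype F]
    (hF : Fintype.card F = q ^ 2) : ∃ φ : F →+* F, ∀ x, φ x = x ^ q := by
  obtain ⟨p, n, hp, -, rfl⟩ := hq
  have : Fact p.Prime := ⟨hp.nat_prime⟩
  have : CharP F p := charP_of_card_eq_prime_pow (f := n * 2) (by rw [hF, pow_mul])
  exact ⟨iterateFrobenius F p n, fun x => iterateFrobenius_def p n x⟩

lemma exists_add_pow_ne_zero {q : ℕ} (hq : 1 < q) {F : Type*} [Field F] [Fintype F]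
    (hF : Fintype.card F = q ^ 2) : ∃ d : F, d + d ^ q ≠ 0 := by
  by_contra! h
  have hdeg : (Polynomial.X + Polynomial.X ^ q : Polynomial F).natDegree = q := by
    rw [Polynomial.natDegree_add_eq_right_of_natDegree_lt] <;> simp [hq]
  have h0 : (Polynomial.X + Polynomial.X ^ q : Polynomial F) = 0 := by
    refine Polynomial.eq_zero_of_natDegree_lt_card_of_eval_eq_zero _ (f := id)
      Function.injective_id (by simpa using h) ?_
    rw [hdeg, hF]
    nlinarith
  rw [h0] at hdeg
  simp at hdeg
  omega

lemma exists_eq_ker_hermForm_of_finrank_eq_four {F : Type*} [Field F] {φ : F →+* F}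
    (hφ : Function.Involutive φ) (W : Submodule F (Fin 5 → F)) (hW : Module.finrank F W = 4) :
    ∃ p : Fin 5 → F, p ≠ 0 ∧ W = LinearMap.ker (hermForm φ p) := by
  have hne : W ≠ ⊤ := by
    rintro rfl
    simp at hW
  obtain ⟨f, hf0, hf⟩ := Submodule.exists_le_ker_of_lt_top W hne.lt_top
  have hfp : hermForm φ (fun i => φ (f (Pi.single i 1))) = f := by
    refine LinearMap.pi_ext' fun i => ?_
    ext
    simp [hermForm_apply, hφ _, Pi.single_apply]
  refine ⟨fun i => φ (f (Pi.single i 1)), fun h => hf0 ?_, ?_⟩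
  · rw [← hfp, h, map_zero]
  · rw [hfp]
    refine Submodule.eq_of_le_of_finrank_le hf ?_
    have h1 := f.finrank_range_add_finrank_ker
    rw [LinearMap.range_eq_top.2 (LinearMap.surjective hf0)] at h1
    simp at h1
    omega

theorem stmt9 (q : ℕ) (hq : IsPrimePow q)
    (F : Type) [Field F] [Fintype F] (hF : Fintype.card F = q ^ 2)
    (Sig1 : Set (P4 F)) (hSig1 : IsHyperplane F Sig1) (htan : ¬ IsTangentHyp q Sig1)
    (S : Set (P4 F)) (hS : IsHyperplane F S) :
    q ^ 3 + 1 ≤ (S ∩ Sig1 ∩ hermV3 q F).ncard := by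
  classical
  have hq1 := hq.one_lt
  obtain ⟨φ, hφq⟩ := exists_ringHom_eq_pow hq hF
  have hφ : Function.Involutive φ := fun x => by
    rw [hφq, hφq, ← pow_mul, ← sq, ← hF, FiniteField.pow_card]
  have htr : ∃ d, d + φ d ≠ 0 := by simpa [hφq] using exists_add_pow_ne_zero hq1 hF
  have hV3 : ∀ P : P4 F, P ∈ hermV3 q F ↔ hermForm φ P.rep P.rep = 0 := fun P => by
    simp [hermV3, hermForm_apply, hφq, pow_succ]
  have hmem : ∀ (W : Submodule F (Fin 5 → F)) (P : P4 F), P.submodule ≤ W ↔ P.rep ∈ W :=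
    fun W P => by rw [Projectivization.submodule_eq, Submodule.span_singleton_le_iff_mem]
  obtain ⟨W₁, hW₁, rfl⟩ := hSig1
  obtain ⟨W₂, hW₂, rfl⟩ := hS
  obtain ⟨p, hp0, rfl⟩ := exists_eq_ker_hermForm_of_finrank_eq_four hφ W₁ hW₁
  have hp : hermForm φ p p ≠ 0 := by
    intro hpp
    obtain ⟨a, ha⟩ := Projectivization.exists_smul_eq_mk_rep F p hp0
    rw [Units.smul_def] at ha
    refine htan ⟨Projectivization.mk F p hp0, ?_, ?_⟩
    · rw [hV3, ← ha, hermForm_smul_self_eq_zero_iff φ a.ne_zero, hpp]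
    · ext P
      have : P ∈ tangentHyp q (Projectivization.mk F p hp0) ↔
          hermForm φ ((a : F) • p) P.rep = 0 := by
        rw [ha]
        simp [tangentHyp, hermForm_apply, hφq]
      rw [this]
      simp [hmem]
  set U := W₂ ⊓ LinearMap.ker (hermForm φ p) with hUdef
  have hU : 3 ≤ Module.finrank F U := by
    have : Module.finrank F W₂ ≤ Module.finrank F U + 1 :=
      finrank_le_finrank_inf_ker_add_one W₂ (hermForm φ p)
    omega
  obtain ⟨v, hv, w, hw, u, hu, hvv, hww, hu0, hvw, hvu, hwu⟩ :=
    exists_orthogonal_triple hφ htr p hp U hU fun x hx => hx.2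
  have hwv : hermForm φ w v = 0 := by rw [← map_hermForm hφ, hvw, map_zero]
  have huv : hermForm φ u v = 0 := by rw [← map_hermForm hφ, hvu, map_zero]
  have huw : hermForm φ u w = 0 := by rw [← map_hermForm hφ, hwu, map_zero]
  let L : F × F × F → Fin 5 → F := fun x => x.2.1 • v + x.2.2 • w + x.1 • u
  have hLU : ∀ x, L x ∈ U := fun x =>
    U.add_mem (U.add_mem (U.smul_mem _ hv) (U.smul_mem _ hw)) (U.smul_mem _ hu)
  have hL : Function.Injective L := by
    intro x y hxy
    have e1 := congrArg (hermForm φ v) hxy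
    have e2 := congrArg (hermForm φ w) hxy
    simp [L, hvw, hvu, hvv] at e1
    simp [L, hwu, hwv, hww] at e2
    simp only [L, e1, e2, add_right_inj] at hxy
    exact Prod.ext (smul_left_injective F hu0 hxy) (Prod.ext e1 e2)
  have hLform : ∀ x, hermForm φ (L x) (L x) = hermForm φ v v * x.2.1 ^ (q + 1) +
      hermForm φ w w * x.2.2 ^ (q + 1) + hermForm φ u u * x.1 ^ (q + 1) := by
    intro x
    simp [L, hvw, hvu, hwu, hwv, huv, huw, hφq]
    ring
  have hcount := le_card_filter_add_add_pow_succ_eq_zero hφq hq1 hF hvv hww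
    (map_hermForm hφ v v) (map_hermForm hφ w w) (map_hermForm hφ u u)
  simp only [← hLform] at hcount
  set Z : Finset (F × F × F) := Finset.univ.filter fun x => hermForm φ (L x) (L x) = 0 with hZ
  have hL0 : L 0 = 0 := by simp [L]
  have h0Z : (0 : F × F × F) ∈ Z := by simp [hZ, hL0]
  set A := {x : P4 F | x.submodule ≤ W₂} ∩
    {x : P4 F | x.submodule ≤ LinearMap.ker (hermForm φ p)} ∩ hermV3 q F with hA
  have hLne : ∀ x : Z.erase 0, L x ≠ 0 := fun x h =>
    (Finset.mem_erase.1 x.2).1 (hL (h.trans hL0.symm))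
  choose c hc using fun x : Z.erase 0 => Projectivization.exists_smul_eq_mk_rep F (L x) (hLne x)
  have hmemA : ∀ x : Z.erase 0, Projectivization.mk F (L x) (hLne x) ∈ A := by
    intro x
    have hxZ : hermForm φ (L x) (L x) = 0 :=
      (Finset.mem_filter.1 (Finset.mem_erase.1 x.2).2).2
    have hrep := hc x
    rw [Units.smul_def] at hrep
    have hU' : ((c x : F) • L x) ∈ U := U.smul_mem _ (hLU x)
    rw [hrep] at hU'
    refine ⟨⟨(hmem _ _).2 hU'.1, (hmem _ _).2 hU'.2⟩, (hV3 _).2 ?_⟩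
    rw [← hrep, hermForm_smul_self_eq_zero_iff φ (c x).ne_zero, hxZ]
  have : Finite (P4 F) := Quotient.finite _
  have hinj : Nat.card (Z.erase 0) ≤ Nat.card (A × Fˣ) := by
    refine Nat.card_le_card_of_injective
      (fun x => (⟨Projectivization.mk F (L x) (hLne x), hmemA x⟩, c x)) ?_
    intro x y hxy
    simp only [Prod.mk.injEq, Subtype.mk.injEq] at hxy
    have h := (hc x).trans ((congrArg Projectivization.rep hxy.1).trans (hc y).symm)
    rw [hxy.2] at h
    exact Subtype.ext (hL (smul_left_cancel _ h))
  rw [Nat.card_prod, Nat.card_coe_set_eq, Nat.card_eq_fintype_card (α := Fˣ), Fintype.card_units,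
    hF, Nat.card_eq_fintype_card, Fintype.card_coe, Finset.card_erase_of_mem h0Z] at hinj
  have hZpos : 0 < Z.card := Finset.card_pos.2 ⟨0, h0Z⟩
  have hq2 : 1 < q ^ 2 := Nat.one_lt_pow two_ne_zero hq1
  zify [hq2.le, Nat.one_le_iff_ne_zero.2 hZpos.ne'] at hinj hcount ⊢
  have hq2' : (0 : ℤ) < (q : ℤ) ^ 2 - 1 := by
    have : (1 : ℤ) < (q : ℤ) ^ 2 := by exact_mod_cast hq2
    linarith
  refine le_of_mul_le_mul_right ?_ hq2'
  linarith [show ((q : ℤ) ^ 3 + 1) * ((q : ℤ) ^ 2 - 1) = q ^ 5 + q ^ 2 - q ^ 3 - 1 by ring]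
end
end
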